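/- Let t > 0 and let C be a constant with E[M] ≤ C √(p · (1 ∨ log(A₀ D_Ω))). Then with probability at least 1 − e^{−t²/2} over the law of Z, the sample path f = Z(·) satisfies: every maximizer x_max of f over Ω lies in CR_t = {x ∈ Ω : UpperCL(x,t) ≥ max_{1≤i≤n} f(x_i)}, and f(x_max) lies in the interval CI_t = [max_{1≤i≤n} f(x_i), sup_{x∈Ω} UpperCL(x,t)]. Here UpperCL(x,t) = μ_f(x) + σ(x) √(log(eσ/σ(x))) · (C √(p (1 ∨ log(A₀ D_Ω))) + t), where μ_f(x) = r(x)ᵀ K⁻¹ (f(x₁),…,f(x_n))ᵀ. -/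

import Mathlib

open MeasureTheory ProbabilityTheory
open scoped RealInnerProductSpace

noncomputable def kmat {p n : ℕ} (Ψ : EuclideanSpace ℝ (Fin p) → ℝ)
    (xs : Fin n → EuclideanSpace ℝ (Fin p)) : Matrix (Fin n) (Fin n) ℝ :=
  Matrix.of fun j k => Ψ (xs j - xs k)

noncomputable def kinterp {p n : ℕ} (Ψ : EuclideanSpace ℝ (Fin p) → ℝ)
    (xs : Fin n → EuclideanSpace ℝ (Fin p)) (f : EuclideanSpace ℝ (Fin p) → ℝ)
    (v : EuclideanSpace ℝ (Fin p)) : ℝ :=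
  ∑ j, ∑ k, Ψ (v - xs j) * (kmat Ψ xs)⁻¹ j k * f (xs k)

noncomputable def krigSd {p n : ℕ} (Ψ : EuclideanSpace ℝ (Fin p) → ℝ)
    (xs : Fin n → EuclideanSpace ℝ (Fin p)) (σ : ℝ)
    (v : EuclideanSpace ℝ (Fin p)) : ℝ :=
  σ * Real.sqrt (1 - ∑ j, ∑ k, Ψ (v - xs j) * (kmat Ψ xs)⁻¹ j k * Ψ (v - xs k))

noncomputable def krigRatio {p n : ℕ} (Ψ : EuclideanSpace ℝ (Fin p) → ℝ)
    (xs : Fin n → EuclideanSpace ℝ (Fin p)) (σ : ℝ)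
    (f : EuclideanSpace ℝ (Fin p) → ℝ) (v : EuclideanSpace ℝ (Fin p)) : ℝ :=
  (f v - kinterp Ψ xs f v) /
    (krigSd Ψ xs σ v * Real.sqrt (Real.log (Real.exp 1 * σ / krigSd Ψ xs σ v)))

def GaussCov {p : ℕ} {Ω' : Type*} [MeasurableSpace Ω'] (P : Measure Ω')
    (Z : EuclideanSpace ℝ (Fin p) → Ω' → ℝ) (σ : ℝ)
    (Ψ : EuclideanSpace ℝ (Fin p) → ℝ) : Prop :=
  ∀ (m : ℕ) (c : Fin m → ℝ) (y : Fin m → EuclideanSpace ℝ (Fin p)),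
    Measure.map (fun ω' => ∑ i, c i * Z (y i) ω') P =
      gaussianReal 0 (∑ i, ∑ j, c i * c j * (σ ^ 2 * Ψ (y i - y j))).toNNReal

def IsSpectralDensity {p : ℕ} (Ψ Ψt : EuclideanSpace ℝ (Fin p) → ℝ) : Prop :=
  (∀ ω, 0 ≤ Ψt ω) ∧ Integrable Ψt ∧ ((∫ ω, Ψt ω) = 1) ∧
    ∀ v, Ψ v = ∫ ω, Real.cos ⟪ω, v⟫ * Ψt ω

noncomputable def A0 {p : ℕ} (Ψt : EuclideanSpace ℝ (Fin p) → ℝ) : ℝ :=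
  ∫ ω, (∑ i, |ω i|) * Ψt ω

/-- The confidence upper limit `UpperCL(x,t)` of Algorithm 1 of the paper, for the data
`(x_i, f(x_i))`: `μ_f(x) + σ(x)√(log(eσ/σ(x))) (C√(p(1 ∨ log(A₀D_Ω))) + t)`, where the
constant `B` stands for `√(p (1 ∨ log(A₀ D_Ω)))`. -/
noncomputable def upperCL {p n : ℕ} (Ψ : EuclideanSpace ℝ (Fin p) → ℝ)
    (xs : Fin n → EuclideanSpace ℝ (Fin p)) (σ C B t : ℝ)
    (f : EuclideanSpace ℝ (Fin p) → ℝ) (v : EuclideanSpace ℝ (Fin p)) : ℝ :=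
  kinterp Ψ xs f v +
    krigSd Ψ xs σ v * Real.sqrt (Real.log (Real.exp 1 * σ / krigSd Ψ xs σ v)) *
      (C * B + t)


section conc
variable {ι : Type*} [Fintype ι]

structure NiceF (L : ℝ) (f : (ι → ℝ) → ℝ) (w : (ι → ℝ) → ι → ℝ) : Prop where
  lip : ∀ x y, |f (x + y) - f x| ≤ ‖y‖
  wmeas : Measurable w
  wnn : ∀ x i, 0 ≤ w x i
  wsum : ∀ x, ∑ i, w x i = 1
  tay : ∀ x y, |f (x + y) - f x - ∑ i, w x i * y i| ≤ L * ‖y‖ ^ 2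

lemma NiceF.cont {L : ℝ} {f : (ι → ℝ) → ℝ} {w : (ι → ℝ) → ι → ℝ} (h : NiceF L f w) :
    Continuous f := by
  have : LipschitzWith 1 f := by
    refine LipschitzWith.of_dist_le_mul fun x y => ?_
    have := h.lip y (x - y)
    rw [add_sub_cancel] at this
    simpa [Real.dist_eq, dist_eq_norm] using this
  exact this.continuous

lemma int_exp_norm (μ : Measure (ι → ℝ)) [IsGaussian μ] (a : ℝ) :
    Integrable (fun y => Real.exp (a * ‖y‖)) μ := by
  obtain ⟨C, hC, hi⟩ := IsGaussian.exists_integrable_exp_sq μ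
  refine (hi.const_mul (Real.exp (a ^ 2 / (4 * C)))).mono' (by fun_prop) (ae_of_all _ fun y => ?_)
  rw [Real.norm_eq_abs, abs_of_pos (Real.exp_pos _), ← Real.exp_add]
  apply Real.exp_le_exp.2
  have : 0 ≤ (a / (2 * C) - ‖y‖) ^ 2 * C := by positivity
  have e : (a / (2 * C) - ‖y‖) ^ 2 * C = a ^ 2 / (4 * C) + C * ‖y‖ ^ 2 - a * ‖y‖ := by
    field_simp; ring
  linarith

/-- domination -/
lemma int_of_exp_bd (μ : Measure (ι → ℝ)) [IsGaussian μ] {g : (ι → ℝ) → ℝ}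
    (hg : AEStronglyMeasurable g μ) (c a : ℝ) (h : ∀ y, |g y| ≤ c * Real.exp (a * ‖y‖)) :
    Integrable g μ :=
  ((int_exp_norm μ a).const_mul c).mono' hg (ae_of_all _ h)

lemma exp_taylor3 (u : ℝ) : Real.exp u ≤ 1 + u + u ^ 2 / 2 + |u| ^ 3 * Real.exp |u| := by
  have h := Complex.norm_exp_sub_sum_le_norm_mul_exp (u : ℂ) 3
  have e : (Complex.exp (u : ℂ) - ∑ m ∈ Finset.range 3, (u : ℂ) ^ m / (m.factorial : ℂ)) =
      ((Real.exp u - (1 + u + u ^ 2 / 2) : ℝ) : ℂ) := by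
    simp [Finset.sum_range_succ, Nat.factorial]
  rw [e, Complex.norm_real, Complex.norm_real, Real.norm_eq_abs, Real.norm_eq_abs] at h
  have := (abs_le.1 h).2
  linarith

lemma norm_pow_le_exp (k : ℕ) (r : ℝ) (hr : 0 ≤ r) : r ^ k ≤ Real.exp (k * r) := by
  rw [Real.exp_nat_mul]
  exact pow_le_pow_left₀ hr (by linarith [Real.add_one_le_exp r]) _

lemma int_norm_pow (μ : Measure (ι → ℝ)) [IsGaussian μ] (k : ℕ) :
    Integrable (fun y => ‖y‖ ^ k) μ := by
  refine int_of_exp_bd μ (by fun_prop) 1 k fun y => ?_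
  rw [abs_of_nonneg (by positivity), one_mul]
  exact norm_pow_le_exp k _ (norm_nonneg y)

lemma int_cubic (μ : Measure (ι → ℝ)) [IsGaussian μ] (l K : ℝ) (hl : 0 ≤ l) (hK : 0 ≤ K) :
    Integrable (fun y => (l * (‖y‖ + K)) ^ 3 * Real.exp (l * (‖y‖ + K))) μ := by
  refine int_of_exp_bd μ (by fun_prop) (Real.exp (4 * (l * K))) (4 * l) fun y => ?_
  have h0 : 0 ≤ l * (‖y‖ + K) := by positivity
  rw [abs_of_nonneg (by positivity)]
  have := norm_pow_le_exp 3 _ h0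
  calc _ ≤ Real.exp (3 * (l * (‖y‖ + K))) * Real.exp (l * (‖y‖ + K)) := by
        gcongr; simpa using this
    _ = _ := by rw [← Real.exp_add, ← Real.exp_add]; congr 1; ring

lemma wdot_abs_le {w y : ι → ℝ} (hw : ∀ i, 0 ≤ w i) (hs : ∑ i, w i = 1) :
    |∑ i, w i * y i| ≤ ‖y‖ := by
  calc |∑ i, w i * y i| ≤ ∑ i, |w i * y i| := Finset.abs_sum_le_sum_abs _ _
    _ ≤ ∑ i, w i * ‖y‖ := by
        refine Finset.sum_le_sum fun i _ => ?_
        rw [abs_mul, abs_of_nonneg (hw i)]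
        exact mul_le_mul_of_nonneg_left (norm_le_pi_norm y i) (hw i)
    _ = ‖y‖ := by rw [← Finset.sum_mul, hs, one_mul]

lemma wdot_sq_le {w y : ι → ℝ} (hw : ∀ i, 0 ≤ w i) (hs : ∑ i, w i = 1) :
    (∑ i, w i * y i) ^ 2 ≤ ∑ i, w i * y i ^ 2 := by
  have := (even_two.convexOn_pow (𝕜 := ℝ)).map_sum_le (t := Finset.univ) (w := w) (p := y)
    (fun i _ => hw i) hs (fun i _ => Set.mem_univ _)
  simpa using this

lemma integral_lin4 {α : Type*} [MeasurableSpace α] (μ : Measure α) [IsProbabilityMeasure μ]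
    (a b c d : ℝ) {f g h : α → ℝ} (hf : Integrable f μ) (hg : Integrable g μ)
    (hh : Integrable h μ) :
    ∫ y, (a + b * f y + c * g y + d * h y) ∂μ =
      a + b * (∫ y, f y ∂μ) + c * (∫ y, g y ∂μ) + d * (∫ y, h y ∂μ) := by
  have i1 : Integrable (fun y => a + b * f y) μ := (integrable_const _).add (hf.const_mul _)
  have i2 : Integrable (fun y => a + b * f y + c * g y) μ := i1.add (hg.const_mul _)
  rw [integral_add i2 (hh.const_mul _), integral_add i1 (hg.const_mul _),
    integral_add (integrable_const _) (hf.const_mul _), integral_const_mul, integral_const_mul,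
    integral_const_mul]
  simp

lemma one_step (μ : Measure (ι → ℝ)) [IsGaussian μ] (hvar : ∀ i, ∫ y, y i ^ 2 ∂μ ≤ 1)
    (l L : ℝ) (hl : 0 ≤ l) (hL : 0 ≤ L) :
    ∃ C : ℝ, 0 ≤ C ∧ ∀ (f : (ι → ℝ) → ℝ) (w : (ι → ℝ) → ι → ℝ), NiceF L f w → ∀ (x : ι → ℝ)
      (q : ℝ), 0 ≤ q → q ≤ 1 →
      ∫ y, Real.exp (l * f (x + q • y)) ∂μ ≤
        Real.exp (l * (∫ y, f (x + q • y) ∂μ) + l ^ 2 * q ^ 2 / 2 + C * q ^ 3) := by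
  set K : ℝ := ∫ y, ‖y‖ ∂μ with hK
  have hK0 : 0 ≤ K := integral_nonneg fun y => norm_nonneg y
  set C1 : ℝ := ∫ y, (l * (‖y‖ + K)) ^ 3 * Real.exp (l * (‖y‖ + K)) ∂μ with hC1
  set C2 : ℝ := ∫ y, (2 * L * ‖y‖ ^ 3 + L ^ 2 * ‖y‖ ^ 4) ∂μ with hC2
  have iC2 : Integrable (fun y : ι → ℝ => 2 * L * ‖y‖ ^ 3 + L ^ 2 * ‖y‖ ^ 4) μ :=
    ((int_norm_pow μ 3).const_mul _).add ((int_norm_pow μ 4).const_mul _)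
  have hC10 : 0 ≤ C1 := integral_nonneg fun y => by positivity
  have hC20 : 0 ≤ C2 := integral_nonneg fun y => by positivity
  refine ⟨l ^ 2 * C2 / 2 + C1, by positivity, fun f w hf x q hq0 hq1 => ?_⟩
  have hfc := hf.cont
  have hn1 : Integrable (fun y : ι → ℝ => ‖y‖) μ := by simpa using int_norm_pow μ 1
  set g : (ι → ℝ) → ℝ := fun y => f (x + q • y) - f x with hg
  have gc : Continuous g := by fun_prop
  have gb : ∀ y, |g y| ≤ q * ‖y‖ := fun y => by
    have := hf.lip x (q • y)
    rwa [norm_smul, Real.norm_eq_abs, abs_of_nonneg hq0] at this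
  have gi : Integrable g μ := (hn1.const_mul q).mono' (by fun_prop) (ae_of_all _ gb)
  set m : ℝ := ∫ y, g y ∂μ with hm
  have hmb : |m| ≤ q * K := by
    calc |m| ≤ ∫ y, |g y| ∂μ := abs_integral_le_integral_abs
      _ ≤ ∫ y, q * ‖y‖ ∂μ := integral_mono gi.abs (hn1.const_mul q) gb
      _ = q * K := by rw [integral_const_mul]
  have hmf : ∫ y, f (x + q • y) ∂μ = m + f x := by
    have : ∀ y, f (x + q • y) = g y + f x := fun y => by simp [hg]
    simp_rw [this]
    rw [integral_add gi (integrable_const _)]; simp [hm]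
  have gsb : ∀ y, (g y) ^ 2 ≤ q ^ 2 * (∑ i, w x i * y i ^ 2)
      + q ^ 3 * (2 * L * ‖y‖ ^ 3 + L ^ 2 * ‖y‖ ^ 4) := fun y => by
    have ht := hf.tay x (q • y)
    have hd := wdot_abs_le (y := y) (hf.wnn x) (hf.wsum x)
    have hs := wdot_sq_le (y := y) (hf.wnn x) (hf.wsum x)
    have e1 : ∑ i, w x i * (q • y) i = q * ∑ i, w x i * y i := by
      rw [Finset.mul_sum]; refine Finset.sum_congr rfl fun i _ => ?_
      simp; ring
    rw [e1, norm_smul, Real.norm_eq_abs, abs_of_nonneg hq0] at ht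
    change |g y - q * ∑ i, w x i * y i| ≤ _ at ht
    set d := ∑ i, w x i * y i
    set N := ‖y‖
    have hN : 0 ≤ N := norm_nonneg _
    have h1 : |g y| ≤ q * |d| + L * q ^ 2 * N ^ 2 := by
      have := abs_add_le (g y - q * d) (q * d)
      rw [sub_add_cancel, abs_mul, abs_of_nonneg hq0] at this
      nlinarith
    have h2 : g y ^ 2 ≤ (q * |d| + L * q ^ 2 * N ^ 2) ^ 2 := by
      rw [← sq_abs]; exact pow_le_pow_left₀ (abs_nonneg _) h1 2
    have h3 : (q * |d| + L * q ^ 2 * N ^ 2) ^ 2 = q ^ 2 * d ^ 2 + 2 * L * q ^ 3 * N ^ 2 * |d|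
        + L ^ 2 * N ^ 4 * (q ^ 3 * q) := by rw [← sq_abs d]; ring
    have h4 : 2 * L * q ^ 3 * N ^ 2 * |d| ≤ 2 * L * q ^ 3 * N ^ 2 * N := by gcongr
    have h5 : L ^ 2 * N ^ 4 * (q ^ 3 * q) ≤ L ^ 2 * N ^ 4 * (q ^ 3 * 1) := by gcongr
    have h6 : q ^ 2 * d ^ 2 ≤ q ^ 2 * (∑ i, w x i * y i ^ 2) := by gcongr
    nlinarith
  have i2 : ∀ i, Integrable (fun y : ι → ℝ => y i ^ 2) μ := fun i =>
    (int_norm_pow μ 2).mono' ((measurable_pi_apply i).pow_const 2).aestronglyMeasurable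
      (ae_of_all _ fun y => by
      rw [Real.norm_eq_abs, abs_pow]
      exact pow_le_pow_left₀ (abs_nonneg _) (norm_le_pi_norm y i) 2)
  have iw : Integrable (fun y : ι → ℝ => ∑ i, w x i * y i ^ 2) μ :=
    integrable_finsetSum _ fun i _ => (i2 i).const_mul _
  have g2i : Integrable (fun y => g y ^ 2) μ :=
    ((int_norm_pow μ 2).const_mul (q ^ 2)).mono' (by fun_prop) (ae_of_all _ fun y => by
      rw [Real.norm_eq_abs, abs_pow, ← mul_pow]
      exact pow_le_pow_left₀ (abs_nonneg _) (gb y) 2)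
  have hw1 : ∫ y, (∑ i, w x i * y i ^ 2) ∂μ ≤ 1 := by
    rw [integral_finsetSum _ fun i _ => (i2 i).const_mul _]
    simp_rw [integral_const_mul]
    calc _ ≤ ∑ i, w x i * 1 := Finset.sum_le_sum fun i _ =>
          mul_le_mul_of_nonneg_left (hvar i) (hf.wnn x i)
      _ = 1 := by simp [hf.wsum x]
  have hg2 : ∫ y, g y ^ 2 ∂μ ≤ q ^ 2 + q ^ 3 * C2 := by
    calc _ ≤ ∫ y, (q ^ 2 * (∑ i, w x i * y i ^ 2)
      + q ^ 3 * (2 * L * ‖y‖ ^ 3 + L ^ 2 * ‖y‖ ^ 4)) ∂μ :=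
          integral_mono g2i ((iw.const_mul _).add (iC2.const_mul _)) gsb
      _ = q ^ 2 * (∫ y, (∑ i, w x i * y i ^ 2) ∂μ) + q ^ 3 * C2 := by
          rw [integral_add (iw.const_mul _) (iC2.const_mul _), integral_const_mul,
            integral_const_mul]
      _ ≤ _ := by nlinarith [sq_nonneg q]
  have hY2 : ∫ y, (g y - m) ^ 2 ∂μ ≤ q ^ 2 + q ^ 3 * C2 := by
    have : ∫ y, (g y - m) ^ 2 ∂μ = ∫ y, g y ^ 2 ∂μ - m ^ 2 := by
      have e : ∀ y, (g y - m) ^ 2 = m ^ 2 + (-2 * m) * g y + 1 * g y ^ 2 + 0 * g y :=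
        fun y => by ring
      simp_rw [e]
      rw [integral_lin4 μ _ _ _ _ gi g2i gi, ← hm]
      ring
    nlinarith [sq_nonneg m]
  have iY : Integrable (fun y => g y - m) μ := gi.sub (integrable_const _)
  have iY2 : Integrable (fun y => (g y - m) ^ 2) μ := by
    have e : (fun y => (g y - m) ^ 2) = fun y => g y ^ 2 - (2 * m) * g y + m ^ 2 := by
      ext y; ring
    rw [e]; exact (g2i.sub (gi.const_mul _)).add (integrable_const _)
  have Yb : ∀ y, |g y - m| ≤ q * (‖y‖ + K) := fun y => by
    have := abs_sub (g y) m
    linarith [gb y]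
  have iB := int_cubic μ l K hl hK0
  have pt : ∀ y, Real.exp (l * (g y - m)) ≤ 1 + l * (g y - m) + l ^ 2 / 2 * (g y - m) ^ 2
      + q ^ 3 * ((l * (‖y‖ + K)) ^ 3 * Real.exp (l * (‖y‖ + K))) := fun y => by
    have h := exp_taylor3 (l * (g y - m))
    have hb : |l * (g y - m)| ≤ q * (l * (‖y‖ + K)) := by
      rw [abs_mul, abs_of_nonneg hl]
      calc _ ≤ l * (q * (‖y‖ + K)) := by gcongr; exact Yb y
        _ = _ := by ring
    have h0 : 0 ≤ l * (‖y‖ + K) := by positivity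
    have hb' : |l * (g y - m)| ≤ l * (‖y‖ + K) := by nlinarith
    have : |l * (g y - m)| ^ 3 * Real.exp |l * (g y - m)| ≤
        (q * (l * (‖y‖ + K))) ^ 3 * Real.exp (l * (‖y‖ + K)) := by gcongr
    nlinarith
  have iR : Integrable (fun y => 1 + l * (g y - m) + l ^ 2 / 2 * (g y - m) ^ 2
      + q ^ 3 * ((l * (‖y‖ + K)) ^ 3 * Real.exp (l * (‖y‖ + K)))) μ :=
    (((integrable_const _).add (iY.const_mul l)).add (iY2.const_mul _)).add (iB.const_mul _)
  have iE : Integrable (fun y => Real.exp (l * (g y - m))) μ :=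
    iR.mono' (by fun_prop) (ae_of_all _ fun y => by
      rw [Real.norm_eq_abs, abs_of_pos (Real.exp_pos _)]; exact pt y)
  have main : ∫ y, Real.exp (l * (g y - m)) ∂μ ≤
      1 + (l ^ 2 * q ^ 2 / 2 + (l ^ 2 * C2 / 2 + C1) * q ^ 3) := by
    calc _ ≤ _ := integral_mono iE iR pt
      _ = 1 + l * 0 + l ^ 2 / 2 * (∫ y, (g y - m) ^ 2 ∂μ) + q ^ 3 * C1 := by
        rw [integral_lin4 μ _ _ _ _ iY iY2 iB, integral_sub gi (integrable_const _)]
        simp [hm, hC1]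
      _ ≤ _ := by nlinarith [sq_nonneg l]
  have e2 : ∀ y, Real.exp (l * f (x + q • y)) =
      Real.exp (l * (m + f x)) * Real.exp (l * (g y - m)) := fun y => by
    rw [← Real.exp_add]; congr 1; simp only [hg]; ring
  simp_rw [e2]
  rw [integral_const_mul, hmf, add_assoc, Real.exp_add (l * (m + f x))]
  gcongr
  refine main.trans ?_
  linarith [Real.add_one_le_exp (l ^ 2 * q ^ 2 / 2 + (l ^ 2 * C2 / 2 + C1) * q ^ 3)]

end conc


section conc2
variable {ι : Type*} [Fintype ι]

lemma NiceF.int_comp {L : ℝ} {f : (ι → ℝ) → ℝ} {w : (ι → ℝ) → ι → ℝ} (hf : NiceF L f w)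
    (μ : Measure (ι → ℝ)) [IsGaussian μ] (x : ι → ℝ) (q : ℝ) :
    Integrable (fun y => f (x + q • y)) μ := by
  have hc := hf.cont
  have hn1 : Integrable (fun y : ι → ℝ => ‖y‖) μ := by simpa using int_norm_pow μ 1
  refine ((integrable_const |f x|).add (hn1.const_mul |q|)).mono' (by fun_prop)
    (ae_of_all _ fun y => ?_)
  have := hf.lip x (q • y)
  rw [norm_smul, Real.norm_eq_abs] at this
  have h2 := abs_add_le (f (x + q • y) - f x) (f x)
  rw [sub_add_cancel] at h2
  simp only [Real.norm_eq_abs, Pi.add_apply]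
  linarith

lemma NiceF.abs_le {L : ℝ} {f : (ι → ℝ) → ℝ} {w : (ι → ℝ) → ι → ℝ} (hf : NiceF L f w)
    (y : ι → ℝ) : |f y| ≤ |f 0| + ‖y‖ := by
  have h := hf.lip 0 y
  rw [zero_add] at h
  have h2 := abs_add_le (f y - f 0) (f 0)
  rw [sub_add_cancel] at h2
  linarith

lemma NiceF.int_exp {L : ℝ} {f : (ι → ℝ) → ℝ} {w : (ι → ℝ) → ι → ℝ} (hf : NiceF L f w)
    (μ : Measure (ι → ℝ)) [IsGaussian μ] (l : ℝ) (hl : 0 ≤ l) :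
    Integrable (fun y => Real.exp (l * f y)) μ := by
  have hc := hf.cont
  refine int_of_exp_bd μ (by fun_prop) (Real.exp (l * |f 0|)) l fun y => ?_
  rw [abs_of_pos (Real.exp_pos _), ← Real.exp_add]
  apply Real.exp_le_exp.2
  have := hf.abs_le y
  have h2 := le_abs_self (f y)
  nlinarith

lemma NiceF.w_le_one {L : ℝ} {f : (ι → ℝ) → ℝ} {w : (ι → ℝ) → ι → ℝ} (hf : NiceF L f w)
    (x : ι → ℝ) (i : ι) : w x i ≤ 1 := by
  rw [← hf.wsum x]
  exact Finset.single_le_sum (fun i _ => hf.wnn x i) (Finset.mem_univ i)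

lemma NiceF.avg {L : ℝ} {f : (ι → ℝ) → ℝ} {w : (ι → ℝ) → ι → ℝ} (hf : NiceF L f w)
    (μ : Measure (ι → ℝ)) [IsGaussian μ] (q : ℝ) :
    NiceF L (fun x => ∫ y, f (x + q • y) ∂μ) (fun x i => ∫ y, w (x + q • y) i ∂μ) := by
  have wm : ∀ i, Measurable fun x => w x i := fun i => (measurable_pi_apply i).comp hf.wmeas
  have wi : ∀ x i, Integrable (fun y => w (x + q • y) i) μ := fun x i =>
    (integrable_const (1 : ℝ)).mono' ((wm i).comp (by fun_prop)).aestronglyMeasurable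
      (ae_of_all _ fun y => by
        rw [Real.norm_eq_abs, abs_of_nonneg (hf.wnn _ _)]; exact hf.w_le_one _ _)
  have fi := hf.int_comp μ
  refine ⟨fun x y => ?_, ?_, fun x i => integral_nonneg fun y => hf.wnn _ _, fun x => ?_,
    fun x y => ?_⟩
  · rw [← integral_sub (fi _ _) (fi _ _)]
    calc _ ≤ ∫ z, |f (x + y + q • z) - f (x + q • z)| ∂μ := abs_integral_le_integral_abs
      _ ≤ ∫ z, ‖y‖ ∂μ := integral_mono ((fi _ _).sub (fi _ _)).abs (integrable_const _)
          fun z => by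
            have := hf.lip (x + q • z) y
            simpa [add_right_comm] using this
      _ = ‖y‖ := by simp
  · refine measurable_pi_lambda _ fun i => ?_
    have : StronglyMeasurable (Function.uncurry fun (x y : ι → ℝ) => w (x + q • y) i) :=
      ((wm i).comp (by fun_prop :
        Measurable fun z : (ι → ℝ) × (ι → ℝ) => z.1 + q • z.2)).stronglyMeasurable
    exact this.integral_prod_right.measurable
  · rw [← integral_finsetSum _ fun i _ => wi x i]
    simp [hf.wsum]
  · have e : ∑ i, (∫ z, w (x + q • z) i ∂μ) * y i = ∫ z, ∑ i, w (x + q • z) i * y i ∂μ := by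
      rw [integral_finsetSum _ fun i _ => (wi x i).mul_const _]
      simp_rw [integral_mul_const]
    have is : Integrable (fun z => ∑ i, w (x + q • z) i * y i) μ :=
      integrable_finsetSum _ fun i _ => (wi x i).mul_const _
    have id : Integrable (fun z => f (x + y + q • z) - f (x + q • z)) μ := (fi _ _).sub (fi _ _)
    rw [e, ← integral_sub (fi _ _) (fi _ _), ← integral_sub id is]
    calc _ ≤ ∫ z, |f (x + y + q • z) - f (x + q • z) - ∑ i, w (x + q • z) i * y i| ∂μ :=
          abs_integral_le_integral_abs
      _ ≤ ∫ z, L * ‖y‖ ^ 2 ∂μ := integral_mono (((fi _ _).sub (fi _ _)).sub is).abs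
          (integrable_const _) fun z => by
            have := hf.tay (x + q • z) y
            simpa [add_right_comm] using this
      _ = L * ‖y‖ ^ 2 := by simp

lemma gauss_conv (μ : Measure (ι → ℝ)) [IsGaussian μ] (h0 : ∀ L : StrongDual ℝ (ι → ℝ), μ[L] = 0)
    (a b c : ℝ) (hc : a ^ 2 + b ^ 2 = c ^ 2) (hcp : 0 < c) :
    (μ.prod μ).map (fun z : (ι → ℝ) × (ι → ℝ) => a • z.1 + b • z.2) = μ.map (fun y => c • y) := by
  obtain ⟨θ, hθ1, hθ2⟩ : ∃ θ : ℝ, a = c * Real.cos θ ∧ b = c * Real.sin θ := by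
    set z : ℂ := ⟨a, b⟩
    have hz : ‖z‖ = c := by
      rw [Complex.norm_def, Complex.normSq_mk, ← Real.sqrt_sq hcp.le, ← hc]; congr 1; ring
    have := Complex.norm_mul_cos_arg z
    have h2 := Complex.norm_mul_sin_arg z
    exact ⟨z.arg, by rw [← hz, this], by rw [← hz, h2]⟩
  have hr := IsGaussian.map_rotation_eq_self_of_forall_strongDual_eq_zero h0 θ
  have h1 : (μ.prod μ).map (fun z : (ι → ℝ) × (ι → ℝ) => a • z.1 + b • z.2)
      = ((μ.prod μ).map (ContinuousLinearMap.rotation θ)).map (fun z => c • z.1) := by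
    rw [Measure.map_map (by fun_prop) (by fun_prop)]
    congr 1
    ext z i
    simp [ContinuousLinearMap.rotation_apply, hθ1, hθ2]
    ring
  rw [h1, hr]
  have : (fun z : (ι → ℝ) × (ι → ℝ) => c • z.1) = (fun y => c • y) ∘ Prod.fst := rfl
  rw [this, ← Measure.map_map (by fun_prop) (by fun_prop), Measure.map_fst_prod]
  simp

lemma gauss_conv_int (μ : Measure (ι → ℝ)) [IsGaussian μ]
    (h0 : ∀ L : StrongDual ℝ (ι → ℝ), μ[L] = 0)
    (a b c : ℝ) (hc : a ^ 2 + b ^ 2 = c ^ 2) (hcp : 0 < c) (g : (ι → ℝ) → ℝ) (hg : Continuous g)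
    (hi : Integrable (fun y => g (c • y)) μ) :
    ∫ y, g (c • y) ∂μ = ∫ y, ∫ z, g (a • y + b • z) ∂μ ∂μ ∧
    Integrable (fun y => ∫ z, g (a • y + b • z) ∂μ) μ := by
  have hm := gauss_conv μ h0 a b c hc hcp
  have hi' : Integrable g (μ.map (fun y => c • y)) :=
    (integrable_map_measure (by fun_prop) (by fun_prop)).2 hi
  rw [← hm, integrable_map_measure (by fun_prop) (by fun_prop)] at hi'
  refine ⟨?_, hi'.integral_prod_left⟩
  rw [← integral_map (f := g) (φ := fun y => c • y) (by fun_prop) (by fun_prop), ← hm,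
    integral_map (by fun_prop) (by fun_prop)]
  exact integral_prod _ hi'

lemma iterate_step (μ : Measure (ι → ℝ)) [IsGaussian μ]
    (h0 : ∀ L : StrongDual ℝ (ι → ℝ), μ[L] = 0)
    (l L B q : ℝ) (hl : 0 ≤ l) (hq : 0 < q)
    (hB : ∀ (f : (ι → ℝ) → ℝ) (w : (ι → ℝ) → ι → ℝ), NiceF L f w → ∀ (x : ι → ℝ),
      ∫ y, Real.exp (l * f (x + q • y)) ∂μ ≤ Real.exp (l * (∫ y, f (x + q • y) ∂μ) + B)) (k : ℕ) :
    ∀ (f : (ι → ℝ) → ℝ) (w : (ι → ℝ) → ι → ℝ), NiceF L f w →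
      ∫ y, Real.exp (l * f ((√k * q) • y)) ∂μ ≤
        Real.exp (l * (∫ y, f ((√k * q) • y) ∂μ) + k * B) := by
  induction k with
  | zero => intro f w hf; simp
  | succ k ih =>
    intro f w hf
    have hfc := hf.cont
    have hav := hf.avg μ q
    have hc : (√(k : ℝ) * q) ^ 2 + q ^ 2 = (√((k + 1 : ℕ) : ℝ) * q) ^ 2 := by
      rw [mul_pow, mul_pow, Real.sq_sqrt (by positivity), Real.sq_sqrt (by positivity)]
      push_cast; ring
    have hcp : 0 < √((k + 1 : ℕ) : ℝ) * q := by positivity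
    have hie : ∀ (g : (ι → ℝ) → ℝ) (w : (ι → ℝ) → ι → ℝ), NiceF L g w → ∀ c : ℝ,
        Integrable (fun y => Real.exp (l * g (c • y))) μ := fun g w hg c => by
      have hgc := hg.cont
      refine int_of_exp_bd μ (by fun_prop) (Real.exp (l * |g 0|)) (l * |c|) fun y => ?_
      rw [abs_of_pos (Real.exp_pos _), ← Real.exp_add]
      apply Real.exp_le_exp.2
      have := hg.abs_le (c • y)
      have h2 := le_abs_self (g (c • y))
      rw [norm_smul, Real.norm_eq_abs] at this
      nlinarith
    obtain ⟨e1, i1⟩ := gauss_conv_int μ h0 _ _ _ hc hcp (fun y => Real.exp (l * f y))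
      (by fun_prop) (hie f w hf _)
    have hfi := hf.int_comp μ 0 (√((k + 1 : ℕ) : ℝ) * q)
    simp only [zero_add] at hfi
    obtain ⟨e2, i2⟩ := gauss_conv_int μ h0 _ _ _ hc hcp f hfc hfi
    rw [e1, e2]
    calc _ ≤ ∫ y, Real.exp B * Real.exp (l * (∫ z, f ((√k * q) • y + q • z) ∂μ)) ∂μ := by
          refine integral_mono i1 ((hie _ _ hav _).const_mul _) fun y => ?_
          have := hB f w hf ((√k * q) • y)
          rwa [add_comm, Real.exp_add] at this
      _ ≤ Real.exp B * Real.exp (l * (∫ y, ∫ z, f ((√k * q) • y + q • z) ∂μ ∂μ) + k * B) := by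
          rw [integral_const_mul]
          gcongr
          exact ih _ _ hav
      _ = _ := by rw [← Real.exp_add]; congr 1; push_cast; ring

lemma nice_conc (μ : Measure (ι → ℝ)) [IsGaussian μ]
    (h0 : ∀ L : StrongDual ℝ (ι → ℝ), μ[L] = 0) (hvar : ∀ i, ∫ y, y i ^ 2 ∂μ ≤ 1)
    (l L : ℝ) (hl : 0 ≤ l) (hL : 0 ≤ L) (f : (ι → ℝ) → ℝ) (w : (ι → ℝ) → ι → ℝ)
    (hf : NiceF L f w) :
    ∫ y, Real.exp (l * f y) ∂μ ≤ Real.exp (l * (∫ y, f y ∂μ) + l ^ 2 / 2) := by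
  obtain ⟨C, hC, h⟩ := one_step μ hvar l L hl hL
  have key : ∀ k : ℕ, ∫ y, Real.exp (l * f y) ∂μ ≤
      Real.exp (l * (∫ y, f y ∂μ) + (l ^ 2 / 2 + C * (√((k : ℝ) + 1))⁻¹)) := fun k => by
    set s := √((k : ℝ) + 1) with hs
    have hs0 : 0 < s := by positivity
    have hss : s ^ 2 = k + 1 := Real.sq_sqrt (by positivity)
    have hs1 : 1 ≤ s := by nlinarith [(Nat.cast_nonneg k : (0 : ℝ) ≤ k)]
    have := iterate_step μ h0 l L (l ^ 2 * s⁻¹ ^ 2 / 2 + C * s⁻¹ ^ 3) s⁻¹ hl (by positivity)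
      (fun f w hf x => by
        have := h f w hf x s⁻¹ (by positivity) (inv_le_one_of_one_le₀ hs1)
        rwa [add_assoc] at this) (k + 1) f w hf
    have e : √((k + 1 : ℕ) : ℝ) * s⁻¹ = 1 := by
      push_cast; rw [← hs]; field_simp
    have e2 : (((k + 1 : ℕ) : ℝ)) * (l ^ 2 * s⁻¹ ^ 2 / 2 + C * s⁻¹ ^ 3) = l ^ 2 / 2 + C * s⁻¹ := by
      push_cast; rw [← hss]; field_simp
    rw [e, e2] at this
    simpa using this
  have lim : Filter.Tendsto (fun k : ℕ => Real.exp (l * (∫ y, f y ∂μ) +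
      (l ^ 2 / 2 + C * (√((k : ℝ) + 1))⁻¹))) Filter.atTop
      (nhds (Real.exp (l * (∫ y, f y ∂μ) + (l ^ 2 / 2 + C * 0)))) := by
    refine (Real.continuous_exp.tendsto _).comp ?_
    refine tendsto_const_nhds.add (tendsto_const_nhds.add (tendsto_const_nhds.mul ?_))
    refine tendsto_inv_atTop_zero.comp (Real.tendsto_sqrt_atTop.comp ?_)
    exact Filter.tendsto_atTop_add_const_right _ _ tendsto_natCast_atTop_atTop
  have := ge_of_tendsto' lim key
  simpa using this

end conc2


section conc3
variable {ι : Type*} [Fintype ι]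

lemma lse_nice [Nonempty ι] (β : ℝ) (hβ : 0 < β) :
    NiceF (2 * β) (fun x : ι → ℝ => β⁻¹ * Real.log (∑ i, Real.exp (β * x i)))
      (fun x i => Real.exp (β * x i) / ∑ j, Real.exp (β * x j)) := by
  have Sp : ∀ x : ι → ℝ, 0 < ∑ i, Real.exp (β * x i) := fun x =>
    Finset.sum_pos (fun i _ => Real.exp_pos _) Finset.univ_nonempty
  have wnn : ∀ (x : ι → ℝ) i, 0 ≤ Real.exp (β * x i) / ∑ j, Real.exp (β * x j) := fun x i =>
    div_nonneg (Real.exp_pos _).le (Sp x).le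
  have wsum : ∀ x : ι → ℝ, ∑ i, Real.exp (β * x i) / ∑ j, Real.exp (β * x j) = 1 := fun x => by
    rw [← Finset.sum_div, div_self (Sp x).ne']
  have key : ∀ x y : ι → ℝ, ∃ r : ℝ, β⁻¹ * Real.log (∑ i, Real.exp (β * (x + y) i)) -
      β⁻¹ * Real.log (∑ i, Real.exp (β * x i)) = β⁻¹ * r ∧ r ≤ β * ‖y‖ ∧
      β * (∑ i, Real.exp (β * x i) / (∑ j, Real.exp (β * x j)) * y i) ≤ r ∧
      (β * ‖y‖ ≤ 1 → r ≤ β * (∑ i, Real.exp (β * x i) / (∑ j, Real.exp (β * x j)) * y i) +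
        (β * ‖y‖) ^ 2) := fun x y => by
    set w : ι → ℝ := fun i => Real.exp (β * x i) / ∑ j, Real.exp (β * x j) with hw
    have hwn : ∀ i, 0 ≤ w i := wnn x
    have hws : ∑ i, w i = 1 := wsum x
    have hyb : ∀ i, |y i| ≤ ‖y‖ := fun i => norm_le_pi_norm y i
    set R := ∑ i, w i * Real.exp (β * y i) with hR
    have eR : ∑ i, Real.exp (β * (x + y) i) = (∑ i, Real.exp (β * x i)) * R := by
      rw [hR, Finset.mul_sum]
      refine Finset.sum_congr rfl fun i _ => ?_
      have := (Sp x).ne'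
      rw [hw, Pi.add_apply, mul_add, Real.exp_add]
      field_simp
    have hRp : 0 < R := by
      have := Sp (x + y)
      rw [eR] at this
      exact (pos_iff_pos_of_mul_pos this).1 (Sp x)
    have ed : β * ∑ i, w i * y i = ∑ i, w i * (β * y i) := by
      rw [Finset.mul_sum]; exact Finset.sum_congr rfl fun i _ => by ring
    refine ⟨Real.log R, ?_, ?_, ?_, fun hy => ?_⟩
    · rw [eR, Real.log_mul (Sp x).ne' hRp.ne']; ring
    · rw [Real.log_le_iff_le_exp hRp]
      calc R ≤ ∑ i, w i * Real.exp (β * ‖y‖) := by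
            refine Finset.sum_le_sum fun i _ => mul_le_mul_of_nonneg_left ?_ (hwn i)
            apply Real.exp_le_exp.2
            have := (abs_le.1 (hyb i)).2
            gcongr
        _ = _ := by rw [← Finset.sum_mul, hws, one_mul]
    · rw [Real.le_log_iff_exp_le hRp, ed]
      have := convexOn_exp.map_sum_le (t := Finset.univ) (w := w) (p := fun i => β * y i)
        (fun i _ => hwn i) hws (fun i _ => Set.mem_univ _)
      simpa using this
    · have h1 := Real.log_le_sub_one_of_pos hRp
      have h2 : R ≤ ∑ i, (w i + w i * (β * y i) + w i * (β * ‖y‖) ^ 2) := by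
        refine Finset.sum_le_sum fun i _ => ?_
        have hb : |β * y i| ≤ β * ‖y‖ := by
          rw [abs_mul, abs_of_pos hβ]; gcongr; exact hyb i
        have h3 := Real.abs_exp_sub_one_sub_id_le (hb.trans hy)
        have h4 : (β * y i) ^ 2 ≤ (β * ‖y‖) ^ 2 := by
          rw [← sq_abs (β * y i)]; exact pow_le_pow_left₀ (abs_nonneg _) hb 2
        have h5 := (abs_le.1 h3).2
        have : Real.exp (β * y i) ≤ 1 + β * y i + (β * ‖y‖) ^ 2 := by linarith
        calc _ ≤ w i * (1 + β * y i + (β * ‖y‖) ^ 2) := mul_le_mul_of_nonneg_left this (hwn i)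
          _ = _ := by ring
      rw [Finset.sum_add_distrib, Finset.sum_add_distrib, hws, ← Finset.sum_mul, hws, ← ed] at h2
      linarith
  refine ⟨fun x y => ?_, ?_, wnn, wsum, fun x y => ?_⟩
  · obtain ⟨r, e, h1, h2, h3⟩ := key x y
    have hd := wdot_abs_le (y := y) (wnn x) (wsum x)
    simp only [e]
    have h4 := (abs_le.1 hd).1
    rw [abs_mul, abs_of_pos (inv_pos.2 hβ), inv_mul_le_iff₀ hβ, abs_le]
    exact ⟨by nlinarith, h1⟩
  · refine measurable_pi_lambda _ fun i => ?_
    fun_prop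
  · obtain ⟨r, e, h1, h2, h3⟩ := key x y
    have hd := wdot_abs_le (y := y) (wnn x) (wsum x)
    simp only [e]
    set d := ∑ i, Real.exp (β * x i) / (∑ j, Real.exp (β * x j)) * y i
    have h4 := (abs_le.1 hd).1
    have e5 : β⁻¹ * r - d = β⁻¹ * (r - β * d) := by field_simp
    rw [e5, abs_mul, abs_of_pos (inv_pos.2 hβ), inv_mul_le_iff₀ hβ, abs_of_nonneg (by linarith)]
    have hN := norm_nonneg y
    by_cases hy : β * ‖y‖ ≤ 1
    · have := h3 hy; nlinarith [mul_nonneg hβ.le hN]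
    · push Not at hy; nlinarith [mul_nonneg hβ.le hN]

lemma sup_abs_le [Nonempty ι] (y : ι → ℝ) :
    |Finset.univ.sup' Finset.univ_nonempty y| ≤ ‖y‖ := by
  obtain ⟨i, _, hi⟩ := Finset.exists_mem_eq_sup' Finset.univ_nonempty y
  rw [hi]; exact norm_le_pi_norm y i

lemma max_conc [Nonempty ι] (μ : Measure (ι → ℝ)) [IsGaussian μ]
    (h0 : ∀ L : StrongDual ℝ (ι → ℝ), μ[L] = 0) (hvar : ∀ i, ∫ y, y i ^ 2 ∂μ ≤ 1)
    (l : ℝ) (hl : 0 ≤ l) :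
    ∫ y, Real.exp (l * Finset.univ.sup' Finset.univ_nonempty y) ∂μ ≤
      Real.exp (l * (∫ y, Finset.univ.sup' Finset.univ_nonempty y ∂μ) + l ^ 2 / 2) := by
  set F : (ι → ℝ) → ℝ := fun y => Finset.univ.sup' Finset.univ_nonempty y with hF
  have Fm : Measurable F := by
    have : F = Finset.univ.sup' Finset.univ_nonempty (fun i (y : ι → ℝ) => y i) := by
      ext y; simp [hF, Finset.sup'_apply]
    rw [this]
    exact Finset.measurable_sup' _ fun i _ => measurable_pi_apply i
  have Fi : Integrable F μ := by
    have hn1 : Integrable (fun y : ι → ℝ => ‖y‖) μ := by simpa using int_norm_pow μ 1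
    exact hn1.mono' Fm.aestronglyMeasurable (ae_of_all _ fun y => sup_abs_le y)
  have Fe : Integrable (fun y => Real.exp (l * F y)) μ := by
    refine int_of_exp_bd μ (by fun_prop) 1 l fun y => ?_
    rw [abs_of_pos (Real.exp_pos _), one_mul]
    apply Real.exp_le_exp.2
    have := (le_abs_self _).trans (sup_abs_le y)
    gcongr
  set N : ℝ := Real.log (Fintype.card ι)
  have hcard : (0 : ℝ) < Fintype.card ι := by exact_mod_cast Fintype.card_pos
  have key : ∀ k : ℕ, ∫ y, Real.exp (l * F y) ∂μ ≤
      Real.exp (l * ((∫ y, F y ∂μ) + ((k : ℝ) + 1)⁻¹ * N) + l ^ 2 / 2) := fun k => by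
    set β : ℝ := k + 1
    have hβ : 0 < β := by positivity
    have hn := lse_nice (ι := ι) β hβ
    set f := (fun x : ι → ℝ => β⁻¹ * Real.log (∑ i, Real.exp (β * x i))) with hf
    have Sp : ∀ x : ι → ℝ, 0 < ∑ i, Real.exp (β * x i) := fun x =>
      Finset.sum_pos (fun i _ => Real.exp_pos _) Finset.univ_nonempty
    have lo : ∀ y, F y ≤ f y := fun y => by
      refine Finset.sup'_le _ _ fun i _ => ?_
      rw [hf]; simp only
      rw [le_inv_mul_iff₀ hβ, Real.le_log_iff_exp_le (Sp y)]
      exact Finset.single_le_sum (f := fun i => Real.exp (β * y i))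
        (fun i _ => (Real.exp_pos _).le) (Finset.mem_univ i)
    have hi : ∀ y, f y ≤ F y + β⁻¹ * N := fun y => by
      have : Real.log (∑ i, Real.exp (β * y i)) ≤ N + β * F y := by
        rw [Real.log_le_iff_le_exp (Sp y), Real.exp_add, Real.exp_log hcard]
        calc _ ≤ ∑ i : ι, Real.exp (β * F y) := by
              refine Finset.sum_le_sum fun i _ => ?_
              have : y i ≤ F y := Finset.le_sup' y (Finset.mem_univ i)
              gcongr
          _ = _ := by simp
      calc f y ≤ β⁻¹ * (N + β * F y) := by simp only [hf]; gcongr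
        _ = _ := by field_simp; ring
    have fi := hn.int_comp μ 0 1
    simp only [zero_add, one_smul] at fi
    calc _ ≤ ∫ y, Real.exp (l * f y) ∂μ := integral_mono Fe (hn.int_exp μ l hl) fun y => by
            have := lo y
            simp only; gcongr
      _ ≤ _ := nice_conc μ h0 hvar l (2 * β) hl (by positivity) f _ hn
      _ ≤ _ := by
        have : ∫ y, f y ∂μ ≤ ∫ y, (F y + β⁻¹ * N) ∂μ :=
          integral_mono fi (Fi.add (integrable_const _)) hi
        rw [integral_add Fi (integrable_const _)] at this
        simp only [integral_const, probReal_univ, one_smul] at this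
        gcongr
  have lim : Filter.Tendsto (fun k : ℕ => Real.exp (l * ((∫ y, F y ∂μ) + ((k : ℝ) + 1)⁻¹ * N)
      + l ^ 2 / 2)) Filter.atTop
      (nhds (Real.exp (l * ((∫ y, F y ∂μ) + 0 * N) + l ^ 2 / 2))) := by
    refine (Real.continuous_exp.tendsto _).comp ?_
    refine Filter.Tendsto.add (tendsto_const_nhds.mul (tendsto_const_nhds.add
      (Filter.Tendsto.mul ?_ tendsto_const_nhds))) tendsto_const_nhds
    refine tendsto_inv_atTop_zero.comp ?_
    exact Filter.tendsto_atTop_add_const_right _ _ tendsto_natCast_atTop_atTop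
  have := ge_of_tendsto' lim key
  simpa using this

/-- centered Gaussian real law -/
def CG {α : Type*} [MeasurableSpace α] (P : Measure α) (X : α → ℝ) : Prop :=
  ∃ v, P.map X = gaussianReal 0 v

lemma borell_finite [Nonempty ι] {α : Type*} [MeasurableSpace α] (P : Measure α)
    [IsProbabilityMeasure P] (X : ι → α → ℝ) (hX : ∀ i, Measurable (X i))
    (hG : ∀ c : ι → ℝ, CG P (fun a => ∑ i, c i * X i a))
    (hvar : ∀ i, ∫ a, X i a ^ 2 ∂P ≤ 1) (t s : ℝ) (ht : 0 < t)
    (hs : (∫ a, Finset.univ.sup' Finset.univ_nonempty (fun i => X i a) ∂P) + t ≤ s) :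
    P {a | s ≤ Finset.univ.sup' Finset.univ_nonempty (fun i => X i a)} ≤
      ENNReal.ofReal (Real.exp (-t ^ 2 / 2)) := by
  classical
  set T : α → ι → ℝ := fun a i => X i a with hT
  have Tm : Measurable T := measurable_pi_lambda _ hX
  have hL : ∀ L : StrongDual ℝ (ι → ℝ), (fun a => L (T a)) =
      fun a => ∑ i, L (Pi.single i 1) * X i a := fun L => by
    ext a
    have h1 : T a = ∑ i, X i a • (Pi.single i 1 : ι → ℝ) := by
      ext j; simp [hT, Pi.single_apply]
    rw [h1, map_sum]
    simp [mul_comm]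
  have hmap : ∀ L : StrongDual ℝ (ι → ℝ), ∃ v, (P.map T).map L = gaussianReal 0 v := fun L => by
    rw [Measure.map_map (by fun_prop) Tm]
    obtain ⟨v, hv⟩ := hG fun i => L (Pi.single i 1)
    exact ⟨v, by rw [← hv, ← hL]; rfl⟩
  have : IsGaussian (P.map T) := isGaussian_of_map_eq_gaussianReal fun L => by
    obtain ⟨v, hv⟩ := hmap L; exact ⟨0, v, hv⟩
  have h0 : ∀ L : StrongDual ℝ (ι → ℝ), (P.map T)[L] = 0 := fun L => by
    obtain ⟨v, hv⟩ := hmap L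
    have : ∫ x, x ∂((P.map T).map L) = ∫ y, L y ∂(P.map T) :=
      integral_map (by fun_prop) (by fun_prop)
    rw [← this, hv, integral_id_gaussianReal]
  set F : (ι → ℝ) → ℝ := fun y => Finset.univ.sup' Finset.univ_nonempty y with hF
  have Fm : Measurable F := by
    have : F = Finset.univ.sup' Finset.univ_nonempty (fun i (y : ι → ℝ) => y i) := by
      ext y; simp [hF, Finset.sup'_apply]
    rw [this]
    exact Finset.measurable_sup' _ fun i _ => measurable_pi_apply i
  have hv : ∀ i, ∫ y, y i ^ 2 ∂(P.map T) ≤ 1 := fun i => by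
    rw [integral_map (f := fun y : ι → ℝ => y i ^ 2) (by fun_prop) ((measurable_pi_apply i).pow_const 2).aestronglyMeasurable]
    exact hvar i
  have hc := max_conc (P.map T) h0 hv t ht.le
  rw [integral_map (f := fun y => Real.exp (t * F y)) (by fun_prop) (by fun_prop),
    integral_map (f := F) (by fun_prop) (by fun_prop)] at hc
  have Fe : Integrable (fun a => Real.exp (t * F (T a))) P := by
    have : Integrable (fun y => Real.exp (t * F y)) (P.map T) := by
      refine int_of_exp_bd _ (by fun_prop) 1 t fun y => ?_
      rw [abs_of_pos (Real.exp_pos _), one_mul]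
      apply Real.exp_le_exp.2
      have := (le_abs_self _).trans (sup_abs_le y)
      gcongr
    exact (integrable_map_measure (f := T) (g := fun y => Real.exp (t * F y)) (by fun_prop)
      (by fun_prop)).1 this
  have ch := measure_ge_le_exp_mul_mgf (X := fun a => F (T a)) (μ := P) s ht.le Fe
  have e : P {a | s ≤ F (T a)} = ENNReal.ofReal (P.real {a | s ≤ F (T a)}) :=
    (ofReal_measureReal (measure_ne_top _ _)).symm
  change P {a | s ≤ F (T a)} ≤ _
  rw [e]
  apply ENNReal.ofReal_le_ofReal
  refine ch.trans ?_
  calc _ ≤ Real.exp (-t * s) * Real.exp (t * (∫ a, F (T a) ∂P) + t ^ 2 / 2) := by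
        gcongr; exact hc
    _ ≤ _ := by
      rw [← Real.exp_add]
      apply Real.exp_le_exp.2
      have : t * ((∫ a, F (T a) ∂P) + t) ≤ t * s := mul_le_mul_of_nonneg_left hs ht.le
      nlinarith

end conc3


section tail

lemma int_exp_sq_std : Integrable (fun x : ℝ => Real.exp (x ^ 2 / 4)) (gaussianReal 0 1) := by
  rw [gaussianReal_of_var_ne_zero 0 one_ne_zero,
    integrable_withDensity_iff_integrable_smul₀' (measurable_gaussianPDF 0 1).aemeasurable
      (ae_of_all _ fun x => by simp [gaussianPDF])]
  have h : Integrable (fun x : ℝ => (√(2 * Real.pi))⁻¹ * Real.exp (-(1 / 4) * x ^ 2)) :=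
    (integrable_exp_neg_mul_sq (by norm_num)).const_mul _
  refine h.congr (ae_of_all _ fun x => ?_)
  simp only [gaussianPDF, gaussianPDFReal, smul_eq_mul]
  rw [ENNReal.toReal_ofReal (by positivity)]
  simp only [NNReal.coe_one, mul_one, sub_zero]
  rw [mul_assoc, ← Real.exp_add]
  congr 2; ring

lemma CG.aemeas {α : Type*} [MeasurableSpace α] {P : Measure α} {X : α → ℝ}
    (h : CG P X) : AEMeasurable X P := by
  obtain ⟨v, hv⟩ := h
  exact aemeasurable_of_map_neZero (by rw [hv]; infer_instance)

lemma CG.memLp {α : Type*} [MeasurableSpace α] {P : Measure α} {X : α → ℝ}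
    (h : CG P X) : MemLp X 2 P := by
  have hm := h.aemeas
  obtain ⟨v, hv⟩ := h
  have := memLp_id_gaussianReal' (μ := 0) (v := v) 2 (by norm_num)
  rw [← hv] at this
  exact this.comp_of_map hm

lemma CG.law {α : Type*} [MeasurableSpace α] {P : Measure α} {X : α → ℝ}
    (h : CG P X) : P.map X = gaussianReal 0 (∫ a, X a ^ 2 ∂P).toNNReal := by
  have hm := h.aemeas
  obtain ⟨v, hv⟩ := h
  have h1 : ∫ a, X a ^ 2 ∂P = v := by
    have h2 : ∫ x, x ^ 2 ∂(P.map X) = ∫ a, X a ^ 2 ∂P := integral_map hm (by fun_prop)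
    have h3 := variance_fun_id_gaussianReal (μ := 0) (v := v)
    rw [variance_eq_integral measurable_id'.aemeasurable, integral_id_gaussianReal] at h3
    rw [← h2, hv, ← h3]; simp
  rw [h1, hv]; simp

/-- the constant E exp(g²/4) -/
noncomputable def kap : ENNReal :=
  ∫⁻ x : ℝ, ENNReal.ofReal (Real.exp (x ^ 2 / 4)) ∂(gaussianReal 0 1)

lemma kap_ne_top : kap ≠ ⊤ := int_exp_sq_std.lintegral_lt_top.ne

lemma lint_exp_sq {α : Type*} [MeasurableSpace α] {P : Measure α} {X : α → ℝ}
    (h : CG P X) (s : ℝ) (hs : 0 < s) (hv : ∫ a, X a ^ 2 ∂P ≤ s ^ 2) :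
    ∫⁻ a, ENNReal.ofReal (Real.exp ((X a / s) ^ 2 / 4)) ∂P ≤ kap := by
  have hm := h.aemeas
  set v := ∫ a, X a ^ 2 ∂P with hvd
  have hv0 : 0 ≤ v := integral_nonneg fun a => sq_nonneg _
  have hl := h.law
  have hl2 : P.map X = (gaussianReal 0 1).map (√v * ·) := by
    rw [hl, gaussianReal_map_const_mul]
    congr 1
    · simp
    · ext; simp [hv0, ← hvd]
  have e1 : ∫⁻ a, ENNReal.ofReal (Real.exp ((X a / s) ^ 2 / 4)) ∂P =
      ∫⁻ x, ENNReal.ofReal (Real.exp ((x / s) ^ 2 / 4)) ∂(P.map X) :=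
    (lintegral_map' (f := fun x : ℝ => ENNReal.ofReal (Real.exp ((x / s) ^ 2 / 4)))
      (by fun_prop) hm).symm
  rw [e1, hl2, lintegral_map (by fun_prop) (by fun_prop)]
  refine lintegral_mono fun x => ?_
  apply ENNReal.ofReal_le_ofReal
  apply Real.exp_le_exp.2
  have : (√v * x / s) ^ 2 ≤ x ^ 2 := by
    rw [div_pow, mul_pow, Real.sq_sqrt hv0, div_le_iff₀ (by positivity)]
    nlinarith [sq_nonneg x]
  linarith

lemma tail_family {α κ : Type*} [MeasurableSpace α] (P : Measure α) [IsProbabilityMeasure P]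
    (I : ℕ → Finset κ) (D : ℝ) (hD : 1 ≤ D) (hI : ∀ k, ((I k).card : ℝ) ≤ D ^ (k + 1))
    (X : κ → α → ℝ) (s : ℕ → ℝ) (hs : ∀ k, 0 < s k)
    (hX : ∀ k, ∀ i ∈ I k, CG P (X i) ∧ ∫ a, X i a ^ 2 ∂P ≤ s k ^ 2) :
    ∃ A : α → ℝ, Integrable A P ∧ (∀ a, 0 ≤ A a) ∧
      ∀ᵐ a ∂P, ∀ k, ∀ i ∈ I k, |X i a| ≤ A a * (s k * √(k + 1)) := by
  set S : α → ENNReal := fun a => ∑' k, ∑ i ∈ I k,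
    ENNReal.ofReal ((2 * D)⁻¹ ^ (k + 1)) * ENNReal.ofReal (Real.exp ((X i a / s k) ^ 2 / 4)) with hS
  have tm : ∀ k, ∀ i ∈ I k, AEMeasurable (fun a =>
      ENNReal.ofReal ((2 * D)⁻¹ ^ (k + 1)) * ENNReal.ofReal (Real.exp ((X i a / s k) ^ 2 / 4))) P :=
    fun k i hi => by
      have := (hX k i hi).1.aemeas
      fun_prop
  have tm2 : ∀ k, AEMeasurable (fun a => ∑ i ∈ I k,
      ENNReal.ofReal ((2 * D)⁻¹ ^ (k + 1)) * ENNReal.ofReal (Real.exp ((X i a / s k) ^ 2 / 4))) P :=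
    fun k => Finset.aemeasurable_fun_sum _ (tm k)
  have Sm : AEMeasurable S P := AEMeasurable.ennreal_tsum tm2
  have hSi : ∫⁻ a, S a ∂P ≠ ⊤ := by
    rw [lintegral_tsum tm2]
    have b : ∀ k, ∫⁻ a, ∑ i ∈ I k, ENNReal.ofReal ((2 * D)⁻¹ ^ (k + 1)) *
        ENNReal.ofReal (Real.exp ((X i a / s k) ^ 2 / 4)) ∂P ≤
        ENNReal.ofReal ((1 / 2) ^ (k + 1)) * kap := fun k => by
      rw [lintegral_finsetSum' _ (tm k)]
      calc _ ≤ ∑ i ∈ I k, ENNReal.ofReal ((2 * D)⁻¹ ^ (k + 1)) * kap := by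
            refine Finset.sum_le_sum fun i hi => ?_
            rw [lintegral_const_mul' _ _ ENNReal.ofReal_ne_top]
            gcongr
            exact lint_exp_sq (hX k i hi).1 (s k) (hs k) (hX k i hi).2
        _ = ENNReal.ofReal ((I k).card * (2 * D)⁻¹ ^ (k + 1)) * kap := by
            rw [Finset.sum_const, nsmul_eq_mul, ← mul_assoc,
              ENNReal.ofReal_mul (by positivity)]
            simp
        _ ≤ _ := by
            gcongr
            calc _ ≤ D ^ (k + 1) * (2 * D)⁻¹ ^ (k + 1) := by gcongr; exact hI k
              _ = _ := by rw [← mul_pow]; congr 1; field_simp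
    refine ne_top_of_le_ne_top ?_ (ENNReal.tsum_le_tsum b)
    rw [ENNReal.tsum_mul_right]
    refine ENNReal.mul_ne_top ?_ kap_ne_top
    have hsum : Summable (fun k : ℕ => ((1 : ℝ) / 2) ^ (k + 1)) :=
      (summable_nat_add_iff 1).2 summable_geometric_two
    exact hsum.tsum_ofReal_ne_top
  have hSae : ∀ᵐ a ∂P, S a < ⊤ := ae_lt_top' Sm hSi
  set c : ℝ := Real.log (2 * D) with hc
  have hc0 : 0 ≤ c := Real.log_nonneg (by linarith)
  refine ⟨fun a => 2 * (1 + c + (S a).toReal), ?_, fun a => by positivity, ?_⟩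
  · exact ((integrable_const _).add (integrable_toReal_of_lintegral_ne_top Sm hSi)).const_mul _
  · filter_upwards [hSae] with a ha k i hi
    have hle : ENNReal.ofReal ((2 * D)⁻¹ ^ (k + 1)) *
        ENNReal.ofReal (Real.exp ((X i a / s k) ^ 2 / 4)) ≤ S a :=
      (Finset.single_le_sum (f := fun i => ENNReal.ofReal ((2 * D)⁻¹ ^ (k + 1)) *
        ENNReal.ofReal (Real.exp ((X i a / s k) ^ 2 / 4))) (fun _ _ => bot_le) hi).trans
        (ENNReal.le_tsum (f := fun k => ∑ i ∈ I k, ENNReal.ofReal ((2 * D)⁻¹ ^ (k + 1)) *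
        ENNReal.ofReal (Real.exp ((X i a / s k) ^ 2 / 4))) k)
    rw [← ENNReal.ofReal_mul (by positivity), ENNReal.ofReal_le_iff_le_toReal ha.ne] at hle
    set T := (S a).toReal
    set z := X i a / s k with hz
    have hDp : 0 < 2 * D := by linarith
    have hTp : 0 < T := lt_of_lt_of_le (by positivity) hle
    rw [inv_pow, inv_mul_le_iff₀ (by positivity)] at hle
    have h1 : z ^ 2 / 4 ≤ (k + 1) * c + Real.log T := by
      rw [← Real.exp_le_exp, Real.exp_add, Real.exp_log hTp, hc]
      have : Real.exp (((k : ℝ) + 1) * Real.log (2 * D)) = (2 * D) ^ (k + 1) := by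
        have := Real.exp_nat_mul (Real.log (2 * D)) (k + 1)
        rw [Real.exp_log hDp] at this
        rw [← this]; push_cast; rfl
      rw [this]; exact hle
    have h2 := Real.log_le_self hTp.le
    have hk : (0 : ℝ) ≤ k := Nat.cast_nonneg k
    have h3 : z ^ 2 ≤ (2 * (1 + c + T) * √(k + 1)) ^ 2 := by
      rw [mul_pow, Real.sq_sqrt (by positivity)]
      nlinarith [mul_nonneg hk hTp.le, mul_nonneg hk hc0, mul_nonneg hc0 hTp.le,
        mul_nonneg (mul_nonneg hc0 hTp.le) hk, mul_nonneg (mul_nonneg hc0 hc0) hk,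
        mul_nonneg (mul_nonneg hTp.le hTp.le) hk, mul_nonneg hc0 hc0, mul_nonneg hTp.le hTp.le]
    have h4 : |z| ≤ 2 * (1 + c + T) * √(k + 1) := abs_le_of_sq_le_sq h3 (by positivity)
    have h5 : |X i a| = |z| * s k := by
      rw [hz, abs_div, abs_of_pos (hs k)]; field_simp [(hs k).ne']
    rw [h5]
    calc _ ≤ 2 * (1 + c + T) * √(k + 1) * s k := mul_le_mul_of_nonneg_right h4 (hs k).le
      _ = _ := by ring

end tail


lemma exists_nets (p : ℕ) (Ω : Set (EuclideanSpace ℝ (Fin p))) (hb : Bornology.IsBounded Ω) :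
    ∃ (T : ℕ → Finset (EuclideanSpace ℝ (Fin p)))
      (s : ℕ → EuclideanSpace ℝ (Fin p) → EuclideanSpace ℝ (Fin p)) (D : ℝ), 1 ≤ D ∧
      (∀ k, ((T k).card : ℝ) ≤ D ^ (k + 1)) ∧ (∀ k, ∀ u ∈ T k, u ∈ Ω) ∧
      ∀ k, ∀ x ∈ Ω, s k x ∈ T k ∧ ‖x - s k x‖ ≤ p * (1 / 4) ^ k := by
  classical
  obtain ⟨R0, hR0⟩ := hb.exists_norm_le
  obtain ⟨R, hR⟩ := exists_nat_ge R0
  let c : ℕ → EuclideanSpace ℝ (Fin p) → (Fin p → ℤ) := fun k x i => ⌊(4 : ℝ) ^ k * x i⌋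
  let rep : ℕ → (Fin p → ℤ) → EuclideanSpace ℝ (Fin p) := fun k z =>
    if h : ∃ x ∈ Ω, c k x = z then h.choose else 0
  have hrep : ∀ k z, (∃ x ∈ Ω, c k x = z) → rep k z ∈ Ω ∧ c k (rep k z) = z := by
    intro k z h
    have : rep k z = h.choose := dif_pos h
    rw [this]; exact h.choose_spec
  let box : ℕ → Finset (Fin p → ℤ) := fun k =>
    Fintype.piFinset (fun _ => Finset.Icc (-((R : ℤ) * 4 ^ k)) (R * 4 ^ k))
  refine ⟨fun k => ((box k).filter (fun z => ∃ x ∈ Ω, c k x = z)).image (rep k),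
    fun k x => rep k (c k x), ((2 * R + 1) * 4) ^ p, ?_, ?_, ?_, ?_⟩
  · apply one_le_pow₀
    have : (0 : ℝ) ≤ R := by positivity
    linarith
  · intro k
    have h1 : (((box k).filter (fun z => ∃ x ∈ Ω, c k x = z)).image (rep k)).card ≤
        (2 * R * 4 ^ k + 1) ^ p := by
      refine (Finset.card_image_le).trans ((Finset.card_filter_le _ _).trans ?_)
      simp only [box, Fintype.card_piFinset, Int.card_Icc, Finset.prod_const, Finset.card_univ,
        Fintype.card_fin]
      gcongr
      zify
      have h0 : (0 : ℤ) ≤ R * 4 ^ k := by positivity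
      rw [Int.toNat_of_nonneg (by linarith)]
      linarith
    calc ((((box k).filter (fun z => ∃ x ∈ Ω, c k x = z)).image (rep k)).card : ℝ)
        ≤ (2 * R * 4 ^ k + 1) ^ p := by exact_mod_cast h1
      _ ≤ (((2 * R + 1) * 4) ^ (k + 1)) ^ p := by
        gcongr
        have : (0 : ℝ) ≤ R := by positivity
        have h4 : (1 : ℝ) ≤ 4 ^ k := one_le_pow₀ (by norm_num)
        have h5 : (1 : ℝ) ≤ (2 * R + 1) ^ k := one_le_pow₀ (by linarith)
        rw [mul_pow, pow_succ, pow_succ]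
        calc 2 * (R : ℝ) * 4 ^ k + 1 ≤ (1 * (2 * R + 1)) * (4 ^ k * 1) := by nlinarith
          _ ≤ _ := by gcongr; norm_num
      _ = _ := by rw [← pow_mul, ← pow_mul, mul_comm (k + 1) p]
  · intro k u hu
    simp only [Finset.mem_image, Finset.mem_filter] at hu
    obtain ⟨z, ⟨_, hz⟩, rfl⟩ := hu
    exact (hrep k z hz).1
  · intro k x hx
    have hc := hrep k (c k x) ⟨x, hx, rfl⟩
    refine ⟨?_, ?_⟩
    · simp only [Finset.mem_image, Finset.mem_filter]
      refine ⟨c k x, ⟨?_, x, hx, rfl⟩, rfl⟩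
      simp only [box, Fintype.mem_piFinset, Finset.mem_Icc, c]
      intro i
      have h1 : |x i| ≤ R := by
        have := (EuclideanSpace.norm_eq x) ▸ (PiLp.norm_apply_le x i)
        have h2 := PiLp.norm_apply_le x i
        rw [Real.norm_eq_abs] at h2
        exact h2.trans ((hR0 x hx).trans hR)
      rw [abs_le] at h1
      have h4 : (0 : ℝ) < 4 ^ k := by positivity
      constructor
      · rw [Int.le_floor]; push_cast; nlinarith
      · have : ((⌊(4 : ℝ) ^ k * x i⌋ : ℤ) : ℝ) ≤ ((R * 4 ^ k : ℤ) : ℝ) := by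
          refine (Int.floor_le _).trans ?_
          push_cast; nlinarith
        exact_mod_cast this
    · set y := rep k (c k x)
      rw [EuclideanSpace.norm_eq]
      apply Real.sqrt_le_iff.2
      refine ⟨by positivity, ?_⟩
      have hi : ∀ i, ‖(x - y) i‖ ^ 2 ≤ ((1 / 4 : ℝ) ^ k) ^ 2 := by
        intro i
        have h1 : c k x i = c k y i := by rw [hc.2]
        have h2 := Int.abs_sub_lt_one_of_floor_eq_floor h1
        rw [← mul_sub, abs_mul, abs_of_pos (by positivity)] at h2
        have h3 : ‖(x - y) i‖ ≤ (1 / 4 : ℝ) ^ k := by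
          rw [Real.norm_eq_abs, one_div, inv_pow, ← one_div, le_div_iff₀ (by positivity)]
          simp only [PiLp.sub_apply]
          linarith
        gcongr
      calc _ ≤ ∑ _i : Fin p, ((1 / 4 : ℝ) ^ k) ^ 2 := Finset.sum_le_sum fun i _ => hi i
        _ = p * ((1 / 4 : ℝ) ^ k) ^ 2 := by simp
        _ ≤ (p : ℝ) ^ 2 * ((1 / 4 : ℝ) ^ k) ^ 2 := by
          gcongr
          exact_mod_cast Nat.le_self_pow two_ne_zero p
        _ = _ := by rw [mul_pow]


lemma chaining {α : Type*} [MeasurableSpace α] (P : Measure α) [IsProbabilityMeasure P]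
    {p : ℕ} (Ω : Set (EuclideanSpace ℝ (Fin p))) (hb : Bornology.IsBounded Ω)
    (Y : EuclideanSpace ℝ (Fin p) → α → ℝ) (hG : ∀ x ∈ Ω, CG P (Y x))
    (hG2 : ∀ x ∈ Ω, ∀ y ∈ Ω, CG P (fun a => Y x a - Y y a))
    (V : ℝ) (hV0 : 0 ≤ V) (hV : ∀ x ∈ Ω, ∀ y ∈ Ω, ∫ a, (Y x a - Y y a) ^ 2 ∂P ≤ V * ‖x - y‖)
    (hc : ∀ᵐ a ∂P, ContinuousOn (fun x => Y x a) Ω) (σ : ℝ) (hσ : 0 < σ) :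
    ∃ A : α → ℝ, Integrable A P ∧ (∀ a, 0 ≤ A a) ∧ ∀ᵐ a ∂P, ∀ x ∈ Ω, ∀ k : ℕ,
      ∫ a, Y x a ^ 2 ∂P ≤ σ ^ 2 * (1 / 4) ^ k → |Y x a| ≤ A a * ((1 / 2) ^ k * √(k + 1)) := by
  classical
  obtain ⟨T, s, D, hD, hT, hTΩ, hs⟩ := exists_nets p Ω hb
  set W : ℝ := 2 * σ ^ 2 + 4 * V * p with hW
  have hW0 : 0 < W := by positivity
  let sc : ℕ → ℝ := fun k => √W * (1 / 2) ^ k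
  have hsc : ∀ k, 0 < sc k := fun k => by positivity
  have hsc2 : ∀ k, sc k ^ 2 = W * (1 / 4) ^ k := fun k => by
    simp only [sc]
    rw [mul_pow, Real.sq_sqrt hW0.le, ← pow_mul, mul_comm k 2, pow_mul]
    norm_num
  obtain ⟨A1, hA1i, hA10, hA1⟩ := tail_family P
    (fun k => (T k).filter (fun u => ∫ a, Y u a ^ 2 ∂P ≤ sc k ^ 2)) D hD
    (fun k => le_trans (by exact_mod_cast Finset.card_filter_le _ _) (hT k)) Y sc hsc
    (fun k u hu => by
      rw [Finset.mem_filter] at hu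
      exact ⟨hG u (hTΩ k u hu.1), hu.2⟩)
  obtain ⟨A2, hA2i, hA20, hA2⟩ := tail_family P
    (fun k => (T k ×ˢ T (k + 1)).filter
      (fun u => ∫ a, (Y u.1 a - Y u.2 a) ^ 2 ∂P ≤ sc k ^ 2)) (D ^ 3) (one_le_pow₀ hD)
    (fun k => by
      refine le_trans (b := (((T k ×ˢ T (k + 1)).card : ℕ) : ℝ))
        (by exact_mod_cast Finset.card_filter_le _ _) ?_
      rw [Finset.card_product, ← pow_mul]
      push_cast
      calc ((T k).card : ℝ) * (T (k + 1)).card ≤ D ^ (k + 1) * D ^ (k + 1 + 1) := by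
            gcongr
            · exact hT k
            · exact hT (k + 1)
        _ = D ^ (k + 1 + (k + 1 + 1)) := by rw [← pow_add]
        _ ≤ _ := pow_le_pow_right₀ hD (by omega))
    (fun u a => Y u.1 a - Y u.2 a) sc hsc
    (fun k u hu => by
      rw [Finset.mem_filter, Finset.mem_product] at hu
      exact ⟨hG2 _ (hTΩ k _ hu.1.1) _ (hTΩ _ _ hu.1.2), hu.2⟩)
  refine ⟨fun a => √W * (A1 a + 4 * A2 a), (hA1i.add (hA2i.const_mul 4)).const_mul _,
    fun a => by have := hA10 a; have := hA20 a; positivity, ?_⟩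
  filter_upwards [hA1, hA2, hc] with a h1 h2 hca x hx k hk
  have hsΩ : ∀ j, s j x ∈ Ω := fun j => hTΩ j _ (hs j x hx).1
  have hpair : ∀ j, |Y (s j x) a - Y (s (j + 1) x) a| ≤ A2 a * (sc j * √(j + 1)) := by
    intro j
    refine h2 j (s j x, s (j + 1) x) ?_
    rw [Finset.mem_filter, Finset.mem_product]
    refine ⟨⟨(hs j x hx).1, (hs (j + 1) x hx).1⟩, ?_⟩
    refine (hV _ (hsΩ j) _ (hsΩ (j + 1))).trans ?_
    rw [hsc2, hW]
    have hn : ‖s j x - s (j + 1) x‖ ≤ 2 * p * (1 / 4) ^ j := by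
      have e : s j x - s (j + 1) x = (x - s (j + 1) x) - (x - s j x) := by abel
      rw [e]
      refine (norm_sub_le _ _).trans ?_
      have e1 := (hs j x hx).2
      have e2 := (hs (j + 1) x hx).2
      have e3 : (p : ℝ) * (1 / 4) ^ (j + 1) ≤ p * (1 / 4) ^ j := by
        gcongr ?_ * ?_
        exact pow_le_pow_of_le_one (by norm_num) (by norm_num) (by omega)
      linarith
    have hq : (0 : ℝ) < (1 / 4) ^ j := by positivity
    calc V * ‖s j x - s (j + 1) x‖ ≤ V * (2 * p * (1 / 4) ^ j) := by gcongr
      _ = (2 * V * p) * (1 / 4) ^ j := by ring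
      _ ≤ _ := by
        gcongr
        have : 0 ≤ V * p := by positivity
        nlinarith [sq_nonneg σ]
  have hsingle : |Y (s k x) a| ≤ A1 a * (sc k * √(k + 1)) := by
    refine h1 k (s k x) ?_
    rw [Finset.mem_filter]
    refine ⟨(hs k x hx).1, ?_⟩
    rw [hsc2]
    have i1 : Integrable (fun a => Y x a ^ 2) P := (hG x hx).memLp.integrable_sq
    have i2 : Integrable (fun a => (Y x a - Y (s k x) a) ^ 2) P :=
      (hG2 x hx _ (hsΩ k)).memLp.integrable_sq
    have i3 : Integrable (fun a => Y (s k x) a ^ 2) P := (hG _ (hsΩ k)).memLp.integrable_sq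
    calc ∫ a, Y (s k x) a ^ 2 ∂P ≤ ∫ a, (2 * Y x a ^ 2 + 2 * (Y x a - Y (s k x) a) ^ 2) ∂P := by
          refine integral_mono i3 ((i1.const_mul 2).add (i2.const_mul 2)) fun a => ?_
          simp only
          nlinarith [sq_nonneg (2 * Y x a - Y (s k x) a)]
      _ = 2 * ∫ a, Y x a ^ 2 ∂P + 2 * ∫ a, (Y x a - Y (s k x) a) ^ 2 ∂P := by
          rw [integral_add (i1.const_mul 2) (i2.const_mul 2), integral_const_mul,
            integral_const_mul]
      _ ≤ 2 * (σ ^ 2 * (1 / 4) ^ k) + 2 * (V * (p * (1 / 4) ^ k)) := by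
          have e1 := hV x hx _ (hsΩ k)
          have e2 : V * ‖x - s k x‖ ≤ V * (p * (1 / 4) ^ k) := by
            gcongr; exact (hs k x hx).2
          linarith
      _ = (2 * σ ^ 2 + 2 * V * p) * (1 / 4) ^ k := by ring
      _ ≤ _ := by
          rw [hW]; gcongr; norm_num
  set b : ℝ := sc k * √(k + 1) with hbd
  have hscale : ∀ i : ℕ, sc (k + i) * √((k + i : ℕ) + 1) ≤ b * ((1 / 2) ^ i * (i + 1)) := by
    intro i
    have e1 : √(((k + i : ℕ) : ℝ) + 1) ≤ √(k + 1) * (i + 1) := by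
      rw [← Real.sqrt_sq (show (0 : ℝ) ≤ i + 1 by positivity), ← Real.sqrt_mul (by positivity)]
      apply Real.sqrt_le_sqrt
      push_cast
      have : (0 : ℝ) ≤ i := by positivity
      have : (0 : ℝ) ≤ k := by positivity
      nlinarith [mul_nonneg ‹(0 : ℝ) ≤ i› ‹(0 : ℝ) ≤ k›, sq_nonneg (i : ℝ),
        mul_nonneg (sq_nonneg (i : ℝ)) ‹(0 : ℝ) ≤ k›]
    calc sc (k + i) * √((k + i : ℕ) + 1) ≤ sc (k + i) * (√(k + 1) * (i + 1)) := by
          have := hsc (k + i); gcongr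
      _ = _ := by simp only [hbd, sc, pow_add]; ring
  have hind : ∀ N : ℕ, |Y (s (k + N) x) a| ≤
      A1 a * b + A2 a * (b * (4 - (2 * N + 4) * (1 / 2) ^ N)) := by
    intro N
    induction N with
    | zero => simpa using hsingle
    | succ N ih =>
      have e1 := hpair (k + N)
      have e2 := mul_le_mul_of_nonneg_left (hscale N) (hA20 a)
      have e3 : |Y (s (k + (N + 1)) x) a| ≤ |Y (s (k + N) x) a| +
          |Y (s (k + N) x) a - Y (s (k + N + 1) x) a| := by
        have := abs_sub_abs_le_abs_sub (Y (s (k + N + 1) x) a) (Y (s (k + N) x) a)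
        rw [abs_sub_comm] at this
        rw [← add_assoc]; linarith
      refine e3.trans ((add_le_add ih (e1.trans e2)).trans (le_of_eq ?_))
      push_cast
      rw [pow_succ]; ring
  have hlim : Filter.Tendsto (fun N => |Y (s (k + N) x) a|) Filter.atTop (nhds |Y x a|) := by
    have t1 : Filter.Tendsto (fun N => s (k + N) x) Filter.atTop (nhds x) := by
      have t0 : Filter.Tendsto (fun j => s j x) Filter.atTop (nhds x) := by
        rw [tendsto_iff_norm_sub_tendsto_zero]
        have t2 : Filter.Tendsto (fun j : ℕ => (p : ℝ) * (1 / 4) ^ j) Filter.atTop (nhds 0) := by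
          simpa using (tendsto_pow_atTop_nhds_zero_of_lt_one (r := (1 / 4 : ℝ))
            (by norm_num) (by norm_num)).const_mul (p : ℝ)
        refine squeeze_zero (fun _ => norm_nonneg _) (fun j => ?_) t2
        rw [norm_sub_rev]; exact (hs j x hx).2
      have := (Filter.tendsto_add_atTop_iff_nat k).2 t0
      simpa only [add_comm] using this
    have t3 := tendsto_nhdsWithin_iff.2 ⟨t1, Filter.Eventually.of_forall fun N => hsΩ (k + N)⟩
    exact ((hca x hx).tendsto.comp t3).abs
  refine le_of_tendsto' hlim fun N => (hind N).trans ?_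
  have hb0 : 0 ≤ b := by have := hsc k; positivity
  have : A2 a * (b * (4 - (2 * N + 4) * (1 / 2) ^ N)) ≤ A2 a * (b * 4) := by
    have := hA20 a
    gcongr
    have : (0 : ℝ) ≤ (2 * N + 4) * (1 / 2) ^ N := by positivity
    linarith
  refine (add_le_add_right this _).trans (le_of_eq ?_)
  simp only [hbd, sc]; ring


lemma one_sub_cos_le_abs (u : ℝ) : 1 - Real.cos u ≤ |u| := by
  have h1 := Real.one_sub_sq_div_two_le_cos (x := u)
  have h2 := Real.neg_one_le_cos u
  rcases le_total |u| 2 with h | h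
  · have : u ^ 2 ≤ 2 * |u| := by
      rw [← sq_abs]; nlinarith [abs_nonneg u]
    linarith
  · linarith

lemma psi_facts {p : ℕ} {Ψ Ψt : EuclideanSpace ℝ (Fin p) → ℝ} (hspec : IsSpectralDensity Ψ Ψt)
    (hA0 : Integrable (fun ω : EuclideanSpace ℝ (Fin p) => (∑ i, |ω i|) * Ψt ω)) :
    Ψ 0 = 1 ∧ (∀ v, Ψ (-v) = Ψ v) ∧ (∀ v, |Ψ v| ≤ 1) ∧ (∀ v, 1 - Ψ v ≤ A0 Ψt * ‖v‖) ∧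
      Continuous Ψ ∧ 0 ≤ A0 Ψt := by
  obtain ⟨h0, hi, h1, hΨ⟩ := hspec
  have hic : ∀ v, Integrable (fun ω => Real.cos ⟪ω, v⟫ * Ψt ω) := fun v => by
    refine hi.bdd_mul (c := 1) (by fun_prop) (ae_of_all _ fun ω => ?_)
    exact Real.abs_cos_le_one _
  refine ⟨?_, ?_, ?_, ?_, ?_, ?_⟩
  · rw [hΨ]; simp [h1]
  · intro v; rw [hΨ, hΨ]; simp
  · intro v
    rw [hΨ, ← Real.norm_eq_abs, ← h1]
    refine norm_integral_le_of_norm_le hi (ae_of_all _ fun ω => ?_)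
    rw [norm_mul, Real.norm_eq_abs, Real.norm_of_nonneg (h0 ω)]
    exact mul_le_of_le_one_left (h0 ω) (Real.abs_cos_le_one _)
  · intro v
    rw [hΨ, ← h1, ← integral_sub hi (hic v), A0, ← integral_mul_const]
    refine integral_mono (hi.sub (hic v)) (hA0.mul_const _) fun ω => ?_
    simp only
    have e1 := one_sub_cos_le_abs ⟪ω, v⟫
    have e2 : |⟪ω, v⟫| ≤ (∑ i, |ω i|) * ‖v‖ := by
      rw [PiLp.inner_apply, Finset.sum_mul]
      refine (Finset.abs_sum_le_sum_abs _ _).trans (Finset.sum_le_sum fun i _ => ?_)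
      have := PiLp.norm_apply_le v i
      rw [Real.norm_eq_abs] at this
      simp only [RCLike.inner_apply, conj_trivial, abs_mul]
      rw [mul_comm]
      gcongr
    calc Ψt ω - Real.cos ⟪ω, v⟫ * Ψt ω = (1 - Real.cos ⟪ω, v⟫) * Ψt ω := by ring
      _ ≤ ((∑ i, |ω i|) * ‖v‖) * Ψt ω := mul_le_mul_of_nonneg_right (e1.trans e2) (h0 ω)
      _ = _ := by ring
  · have : Ψ = fun v => ∫ ω, Real.cos ⟪ω, v⟫ * Ψt ω := funext hΨ
    rw [this]
    refine continuous_of_dominated (bound := Ψt) (fun v => (hic v).aestronglyMeasurable)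
      (fun v => ae_of_all _ fun ω => ?_) hi (ae_of_all _ fun ω => ?_)
    · rw [norm_mul, Real.norm_eq_abs, Real.norm_of_nonneg (h0 ω)]
      exact mul_le_of_le_one_left (h0 ω) (Real.abs_cos_le_one _)
    · fun_prop
  · exact integral_nonneg fun ω => mul_nonneg (Finset.sum_nonneg fun i _ => abs_nonneg _) (h0 ω)

lemma int_sq_of_law {α : Type*} [MeasurableSpace α] {P : Measure α} {X : α → ℝ} {v : NNReal}
    (h : P.map X = gaussianReal 0 v) : ∫ a, X a ^ 2 ∂P = v := by
  have hm : AEMeasurable X P := CG.aemeas ⟨v, h⟩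
  have h2 : ∫ x, x ^ 2 ∂(P.map X) = ∫ a, X a ^ 2 ∂P := integral_map hm (by fun_prop)
  have h3 := variance_fun_id_gaussianReal (μ := 0) (v := v)
  rw [variance_eq_integral measurable_id'.aemeasurable, integral_id_gaussianReal] at h3
  rw [← h2, h, ← h3]; simp

lemma span_CG {p : ℕ} {α : Type*} [MeasurableSpace α] {P : Measure α}
    {Z : EuclideanSpace ℝ (Fin p) → α → ℝ} {σ : ℝ} {Ψ : EuclideanSpace ℝ (Fin p) → ℝ}
    (hg : GaussCov P Z σ Ψ) {X : α → ℝ} (hX : X ∈ Submodule.span ℝ (Set.range Z)) : CG P X := by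
  obtain ⟨c, hc⟩ := Finsupp.mem_span_range_iff_exists_finsupp.1 hX
  have h := hg c.support.card (fun i => c (c.support.equivFin.symm i))
    (fun i => (c.support.equivFin.symm i : EuclideanSpace ℝ (Fin p)))
  refine ⟨_, Eq.trans ?_ h⟩
  congr 1
  ext a
  rw [← hc, Finsupp.sum]
  simp only [Finset.sum_apply, Pi.smul_apply, smul_eq_mul]
  rw [← Finset.sum_coe_sort c.support (fun x => c x * Z x a)]
  exact (Equiv.sum_comp c.support.equivFin.symm (fun x : c.support => c x * Z x a)).symm

lemma int_sq_add {α : Type*} [MeasurableSpace α] {P : Measure α} {U V : α → ℝ}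
    (hU : MemLp U 2 P) (hV : MemLp V 2 P) : ∫ a, (U a + V a) ^ 2 ∂P =
      ∫ a, U a ^ 2 ∂P + ∫ a, V a ^ 2 ∂P + 2 * ∫ a, U a * V a ∂P := by
  have i1 : Integrable (fun a => U a ^ 2) P := hU.integrable_sq
  have i2 : Integrable (fun a => V a ^ 2) P := hV.integrable_sq
  have i3 : Integrable (fun a => 2 * (U a * V a)) P := (hU.integrable_mul hV).const_mul 2
  have i4 : Integrable (fun a => U a ^ 2 + V a ^ 2) P := i1.add i2
  rw [← integral_const_mul, ← integral_add i1 i2, ← integral_add i4 i3]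
  congr 1; ext a; ring

lemma int_sq_sub {α : Type*} [MeasurableSpace α] {P : Measure α} {U V : α → ℝ}
    (hU : MemLp U 2 P) (hV : MemLp V 2 P) : ∫ a, (U a - V a) ^ 2 ∂P =
      ∫ a, U a ^ 2 ∂P + ∫ a, V a ^ 2 ∂P - 2 * ∫ a, U a * V a ∂P := by
  have i1 : Integrable (fun a => U a ^ 2) P := hU.integrable_sq
  have i2 : Integrable (fun a => V a ^ 2) P := hV.integrable_sq
  have i3 : Integrable (fun a => 2 * (U a * V a)) P := (hU.integrable_mul hV).const_mul 2
  have i4 : Integrable (fun a => U a ^ 2 + V a ^ 2) P := i1.add i2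
  rw [← integral_const_mul, ← integral_add i1 i2, ← integral_sub i4 i3]
  congr 1; ext a; ring

lemma cov_Z {p : ℕ} {α : Type*} [MeasurableSpace α] {P : Measure α}
    {Z : EuclideanSpace ℝ (Fin p) → α → ℝ} {σ : ℝ} {Ψ : EuclideanSpace ℝ (Fin p) → ℝ}
    (hg : GaussCov P Z σ Ψ) (h0 : Ψ 0 = 1) (he : ∀ v, Ψ (-v) = Ψ v) (h1 : ∀ v, |Ψ v| ≤ 1)
    (x y : EuclideanSpace ℝ (Fin p)) : ∫ a, Z x a * Z y a ∂P = σ ^ 2 * Ψ (x - y) := by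
  have hZ : ∀ x, CG P (Z x) := fun x => span_CG hg (Submodule.subset_span ⟨x, rfl⟩)
  have hsq : ∀ x, ∫ a, Z x a ^ 2 ∂P = σ ^ 2 := fun x => by
    have h := int_sq_of_law (hg 1 (fun _ => 1) (fun _ => x))
    simp only [Finset.univ_unique, Finset.sum_singleton, one_mul, sub_self, h0, mul_one] at h
    rw [h, Real.coe_toNNReal _ (sq_nonneg σ)]
  have hs : ∫ a, (Z x a + Z y a) ^ 2 ∂P = 2 * σ ^ 2 + 2 * (σ ^ 2 * Ψ (x - y)) := by
    have h := int_sq_of_law (hg 2 (fun _ => 1) ![x, y])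
    simp only [Fin.sum_univ_two, one_mul, Matrix.cons_val_zero, Matrix.cons_val_one, sub_self,
      h0, mul_one] at h
    rw [h, ← neg_sub x y, he, Real.coe_toNNReal]
    · ring
    · have := (abs_le.1 (h1 (x - y))).1
      nlinarith [sq_nonneg σ]
  have e := int_sq_add (hZ x).memLp (hZ y).memLp
  rw [hs, hsq, hsq] at e
  linarith

lemma proc_facts {p : ℕ} {α : Type*} [MeasurableSpace α] {P : Measure α}
    {Z : EuclideanSpace ℝ (Fin p) → α → ℝ} {σ : ℝ} (hσ : 0 < σ)
    {Ψ Ψt : EuclideanSpace ℝ (Fin p) → ℝ} (hspec : IsSpectralDensity Ψ Ψt)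
    (hA0 : Integrable (fun ω : EuclideanSpace ℝ (Fin p) => (∑ i, |ω i|) * Ψt ω))
    (hg : GaussCov P Z σ Ψ) {n : ℕ} (xs : Fin n → EuclideanSpace ℝ (Fin p))
    (hK : IsUnit (kmat Ψ xs).det)
    (Y : EuclideanSpace ℝ (Fin p) → α → ℝ)
    (hY : Y = fun x a => Z x a - kinterp Ψ xs (fun y => Z y a) x) :
    (∀ x, Y x ∈ Submodule.span ℝ (Set.range Z)) ∧
    (∀ x, ∫ a, Y x a ^ 2 ∂P = krigSd Ψ xs σ x ^ 2) ∧
    (∀ x, krigSd Ψ xs σ x ≤ σ) ∧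
    (∀ x y, ∫ a, (Y x a - Y y a) ^ 2 ∂P ≤ 2 * σ ^ 2 * A0 Ψt * ‖x - y‖) ∧
    (∀ i, krigSd Ψ xs σ (xs i) = 0) := by
  obtain ⟨h0, he, h1, hlip, hcont, hA⟩ := psi_facts hspec hA0
  have hcov := cov_Z hg h0 he h1
  let c : EuclideanSpace ℝ (Fin p) → Fin n → ℝ := fun x k =>
    ∑ j, Ψ (x - xs j) * (kmat Ψ xs)⁻¹ j k
  have hZs : ∀ x, Z x ∈ Submodule.span ℝ (Set.range Z) := fun x => Submodule.subset_span ⟨x, rfl⟩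
  have hL : ∀ {X}, X ∈ Submodule.span ℝ (Set.range Z) → MemLp X 2 P := fun h => (span_CG hg h).memLp
  have hI : ∀ {X W}, X ∈ Submodule.span ℝ (Set.range Z) → W ∈ Submodule.span ℝ (Set.range Z) →
      Integrable (fun a => X a * W a) P := fun h h2 => (hL h).integrable_mul (hL h2)
  let S : EuclideanSpace ℝ (Fin p) → α → ℝ := fun x => ∑ k, c x k • Z (xs k)
  have hS : ∀ x, S x ∈ Submodule.span ℝ (Set.range Z) := fun x =>
    Submodule.sum_mem _ fun k _ => Submodule.smul_mem _ _ (hZs _)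
  have hYS : ∀ x, Y x = Z x - S x := by
    intro x; ext a
    simp only [hY, kinterp, S, c, Pi.sub_apply, Finset.sum_apply, Pi.smul_apply, smul_eq_mul]
    rw [Finset.sum_comm]
    simp only [Finset.sum_mul]
  have hYm : ∀ x, Y x ∈ Submodule.span ℝ (Set.range Z) := fun x => by
    rw [hYS]; exact Submodule.sub_mem _ (hZs x) (hS x)
  have hSint : ∀ x (U : α → ℝ), U ∈ Submodule.span ℝ (Set.range Z) →
      ∫ a, S x a * U a ∂P = ∑ k, c x k * ∫ a, Z (xs k) a * U a ∂P := by
    intro x U hU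
    have e : ∀ a, S x a * U a = ∑ k, c x k * (Z (xs k) a * U a) := by
      intro a
      simp only [S, Finset.sum_apply, Pi.smul_apply, smul_eq_mul, Finset.sum_mul, mul_assoc]
    simp only [e]
    rw [integral_finsetSum]
    · simp only [integral_const_mul]
    · intro k _
      exact ((hL (hZs _)).integrable_mul (hL hU)).const_mul _
  have hYZ : ∀ x y, ∫ a, Y x a * Z y a ∂P = σ ^ 2 * (Ψ (x - y) - ∑ k, c x k * Ψ (xs k - y)) := by
    intro x y
    have e : ∀ a, Y x a * Z y a = Z x a * Z y a - S x a * Z y a := by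
      intro a; rw [hYS]; simp only [Pi.sub_apply]; ring
    simp only [e]
    rw [integral_sub (hI (hZs x) (hZs y)) (hI (hS x) (hZs y)), hSint x _ (hZs y)]
    simp only [hcov]
    rw [mul_sub, Finset.mul_sum]
    congr 1
    refine Finset.sum_congr rfl fun k _ => by ring
  have hcK : ∀ x l, ∑ k, c x k * Ψ (xs k - xs l) = Ψ (x - xs l) := by
    intro x l
    have hinv := Matrix.nonsing_inv_mul (kmat Ψ xs) hK
    simp only [c, Finset.sum_mul]
    rw [Finset.sum_comm]
    have : ∀ j, ∑ k, Ψ (x - xs j) * (kmat Ψ xs)⁻¹ j k * Ψ (xs k - xs l) =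
        Ψ (x - xs j) * (1 : Matrix (Fin n) (Fin n) ℝ) j l := by
      intro j
      rw [← hinv, Matrix.mul_apply, Finset.mul_sum]
      refine Finset.sum_congr rfl fun k _ => ?_
      simp only [kmat, Matrix.of_apply]; ring
    simp only [this, Matrix.one_apply]
    simp
  have hYZ0 : ∀ x l, ∫ a, Y x a * Z (xs l) a ∂P = 0 := fun x l => by
    rw [hYZ, hcK, sub_self, mul_zero]
  have hSY : ∀ x y, ∫ a, S x a * Y y a ∂P = 0 := fun x y => by
    rw [hSint x _ (hYm y)]
    refine Finset.sum_eq_zero fun k _ => ?_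
    have : ∫ a, Z (xs k) a * Y y a ∂P = 0 := by
      rw [← hYZ0 y k]; congr 1; ext a; ring
    rw [this, mul_zero]
  have hpy : ∀ (U V : α → ℝ), U ∈ Submodule.span ℝ (Set.range Z) →
      V ∈ Submodule.span ℝ (Set.range Z) → ∫ a, V a * U a ∂P = 0 →
      ∫ a, U a ^ 2 ∂P ≤ ∫ a, (U a + V a) ^ 2 ∂P := by
    intro U V hU hV hUV
    have e := int_sq_add (hL hU) (hL hV)
    simp only [mul_comm (U _) (V _)] at e
    have : 0 ≤ ∫ a, V a ^ 2 ∂P := integral_nonneg fun a => sq_nonneg _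
    rw [e, hUV]; linarith
  have hsum : ∀ x, ∑ j, ∑ k, Ψ (x - xs j) * (kmat Ψ xs)⁻¹ j k * Ψ (x - xs k) =
      ∑ k, c x k * Ψ (xs k - x) := by
    intro x
    rw [Finset.sum_comm]
    refine Finset.sum_congr rfl fun k _ => ?_
    simp only [c]
    rw [Finset.sum_mul, ← neg_sub x (xs k), he]
  have hvar : ∀ x, ∫ a, Y x a ^ 2 ∂P = σ ^ 2 * (1 - ∑ k, c x k * Ψ (xs k - x)) := by
    intro x
    have e : ∀ a, Y x a ^ 2 = Y x a * Z x a - S x a * Y x a := by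
      intro a; rw [hYS]; simp only [Pi.sub_apply]; ring
    simp only [e]
    rw [integral_sub (hI (hYm x) (hZs x)) (hI (hS x) (hYm x)), hSY, hYZ, sub_self, h0, sub_zero]
  have hsd : ∀ x, ∫ a, Y x a ^ 2 ∂P = krigSd Ψ xs σ x ^ 2 := by
    intro x
    have hn : 0 ≤ ∫ a, Y x a ^ 2 ∂P := integral_nonneg fun a => sq_nonneg _
    rw [hvar] at hn ⊢
    have : 0 ≤ 1 - ∑ k, c x k * Ψ (xs k - x) := by
      by_contra hneg
      push Not at hneg
      have : 0 < σ ^ 2 := by positivity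
      nlinarith
    rw [krigSd, hsum, mul_pow, Real.sq_sqrt this]
  have hsq : ∀ x, ∫ a, Z x a ^ 2 ∂P = σ ^ 2 := fun x => by
    have := hcov x x
    rw [sub_self, h0, mul_one] at this
    rw [← this]; congr 1; ext a; ring
  refine ⟨hYm, hsd, ?_, ?_, ?_⟩
  · intro x
    have h := hpy (Y x) (S x) (hYm x) (hS x) (hSY x x)
    rw [hsd] at h
    have e : ∀ a, Y x a + S x a = Z x a := fun a => by rw [hYS]; simp
    simp only [e] at h
    rw [hsq] at h
    exact (abs_le_of_sq_le_sq' h hσ.le).2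
  · intro x y
    have hU := Submodule.sub_mem _ (hYm x) (hYm y)
    have hV := Submodule.sub_mem _ (hS x) (hS y)
    have horth : ∫ a, (S x - S y) a * (Y x - Y y) a ∂P = 0 := by
      have e : ∀ a, (S x - S y) a * (Y x - Y y) a =
          (S x a * Y x a - S x a * Y y a) - (S y a * Y x a - S y a * Y y a) := by
        intro a; simp only [Pi.sub_apply]; ring
      simp only [e]
      have ii : ∀ x y, Integrable (fun a => S x a * Y y a) P := fun x y => hI (hS x) (hYm y)
      have i5 : Integrable (fun a => S x a * Y x a - S x a * Y y a) P := (ii x x).sub (ii x y)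
      have i6 : Integrable (fun a => S y a * Y x a - S y a * Y y a) P := (ii y x).sub (ii y y)
      rw [integral_sub i5 i6,
        integral_sub (ii x x) (ii x y), integral_sub (ii y x) (ii y y)]
      simp [hSY]
    have h := hpy _ _ hU hV horth
    have e : ∀ a, (Y x - Y y) a + (S x - S y) a = Z x a - Z y a := fun a => by
      rw [hYS, hYS]; simp only [Pi.sub_apply]; ring
    simp only [e] at h
    refine h.trans ?_
    have e := int_sq_sub (hL (hZs x)) (hL (hZs y))
    rw [e, hsq, hsq, hcov]
    have := hlip (x - y)
    nlinarith [sq_nonneg σ, mul_le_mul_of_nonneg_left this (sq_nonneg σ)]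
  · intro i
    have h2 : krigSd Ψ xs σ (xs i) ^ 2 = 0 := by
      rw [← hsd, hvar]
      have : ∑ k, c (xs i) k * Ψ (xs k - xs i) = 1 := by rw [hcK, sub_self, h0]
      rw [this]; ring
    exact pow_eq_zero_iff two_ne_zero |>.1 h2


lemma log_ratio_bounds {σ τ : ℝ} (hτ : 0 < τ) (h : τ ≤ σ) :
    1 ≤ Real.log (Real.exp 1 * σ / τ) ∧ Real.log (Real.exp 1 * σ / τ) ≤ σ / τ ∧
      Real.log (Real.exp 1 * σ / τ) = 1 + Real.log (σ / τ) := by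
  have hq : 1 ≤ σ / τ := (one_le_div hτ).2 h
  have e : Real.log (Real.exp 1 * σ / τ) = 1 + Real.log (σ / τ) := by
    rw [mul_div_assoc, Real.log_mul (Real.exp_ne_zero _) (by linarith), Real.log_exp]
  have h1 := Real.log_nonneg hq
  have h2 := Real.log_le_sub_one_of_pos (show 0 < σ / τ by linarith)
  refine ⟨by linarith, by linarith, e⟩

lemma den_le {σ τ : ℝ} (hτ : 0 ≤ τ) (h : τ ≤ σ) :
    τ * √(Real.log (Real.exp 1 * σ / τ)) ≤ σ := by
  rcases hτ.eq_or_lt with h0 | h0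
  · rw [← h0]; simp; linarith
  obtain ⟨h1, h2, _⟩ := log_ratio_bounds h0 h
  have : √(Real.log (Real.exp 1 * σ / τ)) ≤ σ / τ := by
    rw [Real.sqrt_le_iff]
    have : 1 ≤ σ / τ := h1.trans h2
    exact ⟨by linarith, by nlinarith⟩
  calc _ ≤ τ * (σ / τ) := by gcongr
    _ = σ := by field_simp

lemma scale_le {σ τ : ℝ} (hτ : 0 < τ) (h : τ ≤ σ) :
    ∃ k : ℕ, τ ^ 2 ≤ σ ^ 2 * (1 / 4) ^ k ∧
      (1 / 2) ^ k * √((k : ℝ) + 1) ≤ 4 / σ * (τ * √(Real.log (Real.exp 1 * σ / τ))) := by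
  have hσ : 0 < σ := hτ.trans_le h
  obtain ⟨k, hk1, hk2⟩ := exists_nat_pow_near_of_lt_one (x := τ / σ) (y := (1 / 2 : ℝ))
    (by positivity) ((div_le_one hσ).2 h) (by norm_num) (by norm_num)
  refine ⟨k, ?_, ?_⟩
  · rw [div_le_iff₀ hσ] at hk2
    calc τ ^ 2 ≤ ((1 / 2) ^ k * σ) ^ 2 := by gcongr
      _ = _ := by
        rw [mul_pow, ← pow_mul, mul_comm k 2, pow_mul]; norm_num; ring
  · obtain ⟨h1, h2, h3⟩ := log_ratio_bounds hτ h
    have e1 : (k : ℝ) * Real.log 2 ≤ Real.log (σ / τ) := by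
      rw [← Real.log_pow]
      apply Real.log_le_log (by positivity)
      rw [one_div, inv_pow] at hk2
      have := inv_anti₀ (by positivity) hk2
      rwa [inv_inv, inv_div] at this
    have e2 : (k : ℝ) + 1 ≤ 4 * Real.log (Real.exp 1 * σ / τ) := by
      have : (k : ℝ) * (1 / 2) ≤ k * Real.log 2 := by
        gcongr
        have := Real.log_two_gt_d9
        linarith
      have : (0 : ℝ) ≤ k := by positivity
      rw [h3]; linarith
    have e3 : √((k : ℝ) + 1) ≤ 2 * √(Real.log (Real.exp 1 * σ / τ)) := by
      refine (Real.sqrt_le_sqrt e2).trans (le_of_eq ?_)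
      rw [Real.sqrt_mul (by norm_num), show (4 : ℝ) = 2 ^ 2 by norm_num,
        Real.sqrt_sq (by norm_num)]
    have e4 : (1 / 2 : ℝ) ^ k ≤ 2 * (τ / σ) := by
      rw [pow_succ] at hk1; linarith
    calc _ ≤ (2 * (τ / σ)) * (2 * √(Real.log (Real.exp 1 * σ / τ))) := by gcongr
      _ = _ := by field_simp; ring

lemma sup_borell {α ι : Type*} [MeasurableSpace α] (P : Measure α) [IsProbabilityMeasure P]
    [Nonempty ι] (R : ι → α → ℝ) (hRm : ∀ i, Measurable (R i))
    (hG : ∀ (m : ℕ) (c : Fin m → ℝ) (d : Fin m → ι), CG P (fun a => ∑ i, c i * R (d i) a))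
    (hvar : ∀ i, ∫ a, R i a ^ 2 ∂P ≤ 1) (d : ℕ → ι) (A : α → ℝ) (hAi : Integrable A P)
    (hA : ∀ᵐ a ∂P, ∀ i, |R i a| ≤ A a)
    (hd : ∀ᵐ a ∂P, ∀ i, R i a ≤ ⨆ m, R (d m) a) (t s : ℝ) (ht : 0 < t)
    (hs : (∫ a, ⨆ i, R i a ∂P) + t ≤ s) :
    P {a | s < ⨆ i, R i a} ≤ ENNReal.ofReal (Real.exp (-t ^ 2 / 2)) := by
  have hbdd : ∀ a, (∀ i, |R i a| ≤ A a) → BddAbove (Set.range fun i => R i a) := by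
    rintro a h; exact ⟨A a, by rintro _ ⟨i, rfl⟩; exact (le_abs_self _).trans (h i)⟩
  have hbdd2 : ∀ a, (∀ i, |R i a| ≤ A a) → BddAbove (Set.range fun m => R (d m) a) := by
    rintro a h; exact ⟨A a, by rintro _ ⟨i, rfl⟩; exact (le_abs_self _).trans (h _)⟩
  have heq : (fun a => ⨆ i, R i a) =ᵐ[P] fun a => ⨆ m, R (d m) a := by
    filter_upwards [hA, hd] with a h1 h2
    exact le_antisymm (ciSup_le h2) (ciSup_le fun m => le_ciSup (hbdd a h1) (d m))
  have hMm : AEMeasurable (fun a => ⨆ i, R i a) P :=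
    ⟨_, Measurable.iSup fun m => hRm (d m), heq⟩
  have hMi : Integrable (fun a => ⨆ i, R i a) P := by
    refine hAi.mono' hMm.aestronglyMeasurable ?_
    filter_upwards [hA] with a h
    rw [Real.norm_eq_abs, abs_le]
    exact ⟨(abs_le.1 (h (d 0))).1.trans (le_ciSup (hbdd a h) (d 0)),
      ciSup_le fun i => (abs_le.1 (h i)).2⟩
  let F : ℕ → α → ℝ := fun m a =>
    Finset.univ.sup' Finset.univ_nonempty (fun i : Fin (m + 1) => R (d i) a)
  have hFM : ∀ m a, (∀ i, |R i a| ≤ A a) → F m a ≤ ⨆ i, R i a := fun m a h =>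
    Finset.sup'_le _ _ fun i _ => le_ciSup (hbdd a h) (d i)
  have hRF : ∀ m a, R (d m) a ≤ F m a := fun m a =>
    Finset.le_sup' (fun i : Fin (m + 1) => R (d i) a) (Finset.mem_univ (Fin.last m))
  have hFmeas : ∀ m, Measurable (F m) := fun m => by
    have := Finset.measurable_sup' (Finset.univ_nonempty (α := Fin (m + 1)))
      (f := fun i : Fin (m + 1) => R (d i)) (fun i _ => hRm (d i))
    convert this using 1
    ext a; simp only [F, Finset.sup'_apply]
  have hFi : ∀ m, Integrable (F m) P := fun m => by
    refine hAi.mono' (hFmeas m).aestronglyMeasurable ?_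
    filter_upwards [hA] with a h
    rw [Real.norm_eq_abs, abs_le]
    exact ⟨(abs_le.1 (h (d m))).1.trans (hRF m a),
      Finset.sup'_le _ _ fun i _ => (abs_le.1 (h _)).2⟩
  have hFle : ∀ m, ∫ a, F m a ∂P ≤ ∫ a, ⨆ i, R i a ∂P := fun m =>
    integral_mono_ae (hFi m) hMi (by filter_upwards [hA] with a h using hFM m a h)
  have hFb : ∀ m, P {a | s ≤ F m a} ≤ ENNReal.ofReal (Real.exp (-t ^ 2 / 2)) := fun m =>
    borell_finite P (fun i : Fin (m + 1) => R (d i)) (fun i => hRm _) (fun c => hG _ c _)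
      (fun i => hvar _) t s ht (by have := hFle m; simp only [F] at this; linarith)
  have hmono : Monotone (fun m => {a | s ≤ F m a}) := by
    intro m m' hm a ha
    refine le_trans (show s ≤ F m a from ha) (Finset.sup'_le _ _ fun i _ => ?_)
    exact Finset.le_sup' (fun i : Fin (m' + 1) => R (d i) a)
      (Finset.mem_univ (⟨i, by omega⟩ : Fin (m' + 1)))
  calc P {a | s < ⨆ i, R i a} ≤ P (⋃ m, {a | s ≤ F m a}) := by
        refine measure_mono_ae ?_
        filter_upwards [hd] with a h2
        intro (ha : s < ⨆ i, R i a)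
        have h3 : s < ⨆ m, R (d m) a := ha.trans_le (ciSup_le h2)
        obtain ⟨m, hm⟩ := exists_lt_of_lt_ciSup h3
        exact Set.mem_iUnion.2 ⟨m, hm.le.trans (hRF m a)⟩
    _ = ⨆ m, P {a | s ≤ F m a} := hmono.measure_iUnion
    _ ≤ _ := iSup_le hFb


/-- Corollary 2 of the paper: if `E[M] ≤ C √(p (1 ∨ log(A₀ D_Ω)))` then, with probability
at least `1 − e^{−t²/2}` over the law of Z, the sample path `f = Z(·)` satisfies: every
maximizer `x_max` of f over Ω lies in the confidence region
`CR_t = {x ∈ Ω : UpperCL(x,t) ≥ max_i f(x_i)}` and `f(x_max)` lies in the confidence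
interval `CI_t = [max_i f(x_i), sup_{x∈Ω} UpperCL(x,t)]`. -/
theorem stmt3 (p : ℕ) (hp : 0 < p)
    (Ω : Set (EuclideanSpace ℝ (Fin p))) (hΩc : IsCompact Ω) (hΩne : Ω.Nonempty)
    (hΩd : 0 < Metric.diam Ω)
    (Ψ Ψt : EuclideanSpace ℝ (Fin p) → ℝ) (hspec : IsSpectralDensity Ψ Ψt)
    (hA0 : Integrable (fun ω => (∑ i, |ω i|) * Ψt ω))
    (σ : ℝ) (hσ : 0 < σ)
    (Ω' : Type) [MeasurableSpace Ω'] (P : Measure Ω') [IsProbabilityMeasure P]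
    (Z : EuclideanSpace ℝ (Fin p) → Ω' → ℝ) (hZmeas : ∀ x, Measurable (Z x))
    (hZcont : ∀ᵐ ω' ∂P, ContinuousOn (fun x => Z x ω') Ω)
    (hgauss : GaussCov P Z σ Ψ)
    (n : ℕ) (hn : 0 < n) (xs : Fin n → EuclideanSpace ℝ (Fin p)) (hxs : ∀ i, xs i ∈ Ω)
    (hK : IsUnit (kmat Ψ xs).det)
    (C : ℝ)
    (hC : (∫ ω', (⨆ v : Ω, krigRatio Ψ xs σ (fun x => Z x ω') v) ∂P) ≤
      C * Real.sqrt (p * max 1 (Real.log (A0 Ψt * Metric.diam Ω))))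
    (t : ℝ) (ht : 0 < t) :
    ENNReal.ofReal (1 - Real.exp (-t ^ 2 / 2)) ≤
      P {ω' | ∀ xm ∈ Ω, (∀ y ∈ Ω, Z y ω' ≤ Z xm ω') →
          ((⨆ i, Z (xs i) ω') ≤
              upperCL Ψ xs σ C (Real.sqrt (p * max 1 (Real.log (A0 Ψt * Metric.diam Ω)))) t
                (fun x => Z x ω') xm ∧
            (⨆ i, Z (xs i) ω') ≤ Z xm ω' ∧
            Z xm ω' ≤ ⨆ v : Ω,
              upperCL Ψ xs σ C (Real.sqrt (p * max 1 (Real.log (A0 Ψt * Metric.diam Ω)))) t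
                (fun x => Z x ω') v)} := by
  classical
  set B := Real.sqrt (p * max 1 (Real.log (A0 Ψt * Metric.diam Ω))) with hB
  obtain ⟨hΨ0, hΨe, hΨ1, hlip, hΨc, hA⟩ := psi_facts hspec hA0
  let Y : EuclideanSpace ℝ (Fin p) → Ω' → ℝ := fun x a =>
    Z x a - kinterp Ψ xs (fun y => Z y a) x
  obtain ⟨hYs, hYv, hsdσ, hYinc, hsd0⟩ := proc_facts hσ hspec hA0 hgauss xs hK Y rfl
  have hsdn : ∀ x, 0 ≤ krigSd Ψ xs σ x := fun x => mul_nonneg hσ.le (Real.sqrt_nonneg _)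
  have hkc : ∀ f : EuclideanSpace ℝ (Fin p) → ℝ, Continuous (fun v => kinterp Ψ xs f v) := by
    intro f; unfold kinterp; fun_prop
  have hsdc : Continuous (fun v => krigSd Ψ xs σ v) := by
    unfold krigSd; fun_prop
  have hYc : ∀ᵐ a ∂P, ContinuousOn (fun x => Y x a) Ω := by
    filter_upwards [hZcont] with a ha
    exact ha.sub (hkc _).continuousOn
  have hYG : ∀ x, CG P (Y x) := fun x => span_CG hgauss (hYs x)
  obtain ⟨A, hAi, hA0', hAb⟩ := chaining P Ω hΩc.isBounded Y (fun x _ => hYG x)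
    (fun x _ y _ => span_CG hgauss (Submodule.sub_mem _ (hYs x) (hYs y)))
    (2 * σ ^ 2 * A0 Ψt) (by positivity) (fun x _ y _ => hYinc x y) hYc σ hσ
  let den : EuclideanSpace ℝ (Fin p) → ℝ := fun x =>
    krigSd Ψ xs σ x * Real.sqrt (Real.log (Real.exp 1 * σ / krigSd Ψ xs σ x))
  have hdenpos : ∀ x, 0 < krigSd Ψ xs σ x → 0 < den x := fun x hx =>
    mul_pos hx (Real.sqrt_pos.2 (by linarith [(log_ratio_bounds hx (hsdσ x)).1]))
  have hsdle : ∀ x, 0 < krigSd Ψ xs σ x → krigSd Ψ xs σ x ≤ den x := fun x hx =>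
    le_mul_of_one_le_right hx.le (Real.one_le_sqrt.2 (log_ratio_bounds hx (hsdσ x)).1)
  have hden0 : ∀ x, krigSd Ψ xs σ x = 0 → den x = 0 := fun x hx => by simp [den, hx]
  let R : Ω → Ω' → ℝ := fun v a => krigRatio Ψ xs σ (fun x => Z x a) v
  have hRY : ∀ v : Ω, R v = (den v)⁻¹ • Y v := by
    intro v; ext a
    simp only [R, krigRatio, Y, den, Pi.smul_apply, smul_eq_mul]
    rw [div_eq_inv_mul]
  have hRs : ∀ v, R v ∈ Submodule.span ℝ (Set.range Z) := fun v => by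
    rw [hRY]; exact Submodule.smul_mem _ _ (hYs v)
  -- pathwise zero at degenerate points
  have hY0 : ∀ᵐ a ∂P, ∀ x ∈ Ω, krigSd Ψ xs σ x = 0 → Y x a = 0 := by
    filter_upwards [hAb] with a ha x hx h0
    have hb : ∀ k : ℕ, |Y x a| ≤ A a * ((1 / 2) ^ k * √((k : ℝ) + 1)) := fun k => by
      apply ha x hx k
      rw [hYv, h0, zero_pow two_ne_zero]; positivity
    have hlim : Filter.Tendsto (fun k : ℕ => A a * (2 * (((k + 1 : ℕ) : ℝ) * (1 / 2) ^ (k + 1))))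
        Filter.atTop (nhds 0) := by
      have h1 := (Filter.tendsto_add_atTop_iff_nat 1).2
        (tendsto_self_mul_const_pow_of_lt_one (r := (1 / 2 : ℝ)) (by norm_num) (by norm_num))
      simpa using (h1.const_mul 2).const_mul (A a)
    have h2 : |Y x a| ≤ 0 := by
      refine ge_of_tendsto' hlim fun k => (hb k).trans ?_
      refine mul_le_mul_of_nonneg_left ?_ (hA0' a)
      have h3 : √((k : ℝ) + 1) ≤ k + 1 := by
        rw [Real.sqrt_le_iff]
        have : (0 : ℝ) ≤ k := by positivity
        exact ⟨by linarith, by nlinarith⟩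
      have h4 : (0 : ℝ) < (1 / 2) ^ k := by positivity
      rw [pow_succ]; push_cast; nlinarith
    exact abs_eq_zero.1 (le_antisymm h2 (abs_nonneg _))
  have hRA : ∀ᵐ a ∂P, ∀ v, |R v a| ≤ 4 / σ * A a := by
    filter_upwards [hAb] with a ha v
    rw [hRY, Pi.smul_apply, smul_eq_mul]
    have hAa := hA0' a
    rcases (hsdn v).eq_or_lt with h0 | h0
    · rw [hden0 v h0.symm]; simp; positivity
    · obtain ⟨k, hk1, hk2⟩ := scale_le h0 (hsdσ v)
      have h1 := ha v v.2 k (by rw [hYv]; exact hk1)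
      have hd := hdenpos v h0
      rw [abs_mul, abs_of_pos (inv_pos.2 hd), inv_mul_le_iff₀ hd]
      calc |Y v a| ≤ A a * (4 / σ * den v) := h1.trans (by gcongr)
        _ = _ := by ring
  -- countable dense set
  let G : Set (EuclideanSpace ℝ (Fin p)) := {x | x ∈ Ω ∧ 0 < krigSd Ψ xs σ x}
  obtain ⟨c, hcG, hcc, hGc⟩ :=
    (TopologicalSpace.IsSeparable.of_separableSpace G).exists_countable_dense_subset
  obtain ⟨f, hf⟩ := (hcc.insert (xs ⟨0, hn⟩)).exists_eq_range (Set.insert_nonempty _ _)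
  have hfΩ : ∀ m, f m ∈ Ω := fun m => by
    have : f m ∈ insert (xs ⟨0, hn⟩) c := by rw [hf]; exact ⟨m, rfl⟩
    rcases this with h | h
    · rw [h]; exact hxs _
    · exact (hcG h).1
  let d : ℕ → Ω := fun m => ⟨f m, hfΩ m⟩
  have hd : ∀ᵐ a ∂P, ∀ v, R v a ≤ ⨆ m, R (d m) a := by
    filter_upwards [hRA, hYc] with a ha hca v
    have hbd : BddAbove (Set.range fun m => R (d m) a) :=
      ⟨4 / σ * A a, by rintro _ ⟨m, rfl⟩; exact (le_abs_self _).trans (ha _)⟩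
    have hle : ∀ y ∈ insert (xs ⟨0, hn⟩) c, (den y)⁻¹ * Y y a ≤ ⨆ m, R (d m) a := by
      intro y hy
      rw [hf] at hy
      obtain ⟨m, rfl⟩ := hy
      have := le_ciSup hbd m
      simp only [hRY, Pi.smul_apply, smul_eq_mul] at this ⊢
      exact this
    rw [hRY, Pi.smul_apply, smul_eq_mul]
    rcases (hsdn v).eq_or_lt with h0 | h0
    · have h1 := hle (xs ⟨0, hn⟩) (Set.mem_insert _ _)
      rw [hden0 _ (hsd0 _)] at h1
      rw [hden0 v h0.symm]
      simpa using h1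
    · have hvG : (v : EuclideanSpace ℝ (Fin p)) ∈ G := ⟨v.2, h0⟩
      have hcont : ContinuousOn (fun y => (den y)⁻¹ * Y y a) G := by
        refine ContinuousOn.mul (ContinuousOn.inv₀ ?_ fun y hy => (hdenpos y hy.2).ne')
          (hca.mono fun y hy => hy.1)
        refine hsdc.continuousOn.mul (ContinuousOn.sqrt (ContinuousOn.log ?_ ?_))
        · exact continuousOn_const.div hsdc.continuousOn fun y hy => hy.2.ne'
        · intro y hy
          have := hy.2
          positivity
      obtain ⟨u, huc, hu⟩ := mem_closure_iff_seq_limit.1 (hGc hvG)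
      have ht : Filter.Tendsto u Filter.atTop (nhdsWithin (v : EuclideanSpace ℝ (Fin p)) G) :=
        tendsto_nhdsWithin_iff.2 ⟨hu, Filter.Eventually.of_forall fun m => hcG (huc m)⟩
      exact le_of_tendsto' ((hcont v hvG).tendsto.comp ht)
        fun m => hle _ (Set.mem_insert_of_mem _ (huc m))
  have : Nonempty Ω := hΩne.to_subtype
  have hRm : ∀ v, Measurable (R v) := fun v => by
    rw [hRY]
    refine Measurable.const_smul ?_ _
    simp only [Y, kinterp]
    fun_prop
  have hvar : ∀ v, ∫ a, R v a ^ 2 ∂P ≤ 1 := by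
    intro v
    simp only [hRY, Pi.smul_apply, smul_eq_mul, mul_pow]
    rw [integral_const_mul, hYv]
    rcases (hsdn v).eq_or_lt with h0 | h0
    · rw [← h0]; simp
    · have hdv := hdenpos v h0
      rw [← mul_pow]
      refine pow_le_one₀ (by positivity) ?_
      rw [inv_mul_le_iff₀ hdv, mul_one]
      exact hsdle v h0
  have hbor := sup_borell P R hRm
    (fun m c d => by
      refine span_CG hgauss ?_
      have e : (fun a => ∑ i, c i * R (d i) a) = ∑ i, c i • R (d i) := by
        ext a; simp
      rw [e]
      exact Submodule.sum_mem _ fun i _ => Submodule.smul_mem _ _ (hRs _))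
    hvar d (fun a => 4 / σ * A a) (hAi.const_mul _) hRA hd t (C * B + t) ht
    (by simp only [R]; linarith)
  set S : Set Ω' := {ω' | ∀ xm ∈ Ω, (∀ y ∈ Ω, Z y ω' ≤ Z xm ω') →
          ((⨆ i, Z (xs i) ω') ≤ upperCL Ψ xs σ C B t (fun x => Z x ω') xm ∧
            (⨆ i, Z (xs i) ω') ≤ Z xm ω' ∧
            Z xm ω' ≤ ⨆ v : Ω, upperCL Ψ xs σ C B t (fun x => Z x ω') v)} with hS
  have hSc : P Sᶜ ≤ P {a | C * B + t < ⨆ v, R v a} := by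
    refine measure_mono_ae ?_
    filter_upwards [hRA, hY0] with a ha hy0 hnS
    by_contra hns
    apply hnS
    have hM : (⨆ v, R v a) ≤ C * B + t := not_lt.1 hns
    have hbd : BddAbove (Set.range fun v => R v a) :=
      ⟨4 / σ * A a, by rintro _ ⟨m, rfl⟩; exact (le_abs_self _).trans (ha _)⟩
    have hZU : ∀ x ∈ Ω, Z x a ≤ upperCL Ψ xs σ C B t (fun x => Z x a) x := by
      intro x hx
      have hYle : Y x a ≤ den x * (C * B + t) := by
        rcases (hsdn x).eq_or_lt with h0 | h0
        · rw [hy0 x hx h0.symm, hden0 x h0.symm, zero_mul]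
        · have h1 := (le_ciSup hbd ⟨x, hx⟩).trans hM
          simp only [hRY, Pi.smul_apply, smul_eq_mul] at h1
          rwa [inv_mul_le_iff₀ (hdenpos x h0)] at h1
      simp only [Y, den] at hYle
      simp only [upperCL]
      linarith
    intro xm hxm hmax
    have : Nonempty (Fin n) := ⟨⟨0, hn⟩⟩
    have h1 : (⨆ i, Z (xs i) a) ≤ Z xm a := ciSup_le fun i => hmax _ (hxs i)
    refine ⟨h1.trans (hZU xm hxm), h1, (hZU xm hxm).trans ?_⟩
    refine le_ciSup (f := fun v : Ω => upperCL Ψ xs σ C B t (fun x => Z x a) v) ?_ ⟨xm, hxm⟩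
    refine ⟨(∑ j, ∑ k, |(kmat Ψ xs)⁻¹ j k * Z (xs k) a|) + σ * |C * B + t|, ?_⟩
    rintro _ ⟨v, rfl⟩
    simp only [upperCL]
    refine add_le_add ?_ ?_
    · refine Finset.sum_le_sum fun j _ => Finset.sum_le_sum fun k _ => ?_
      refine (le_abs_self _).trans ?_
      rw [mul_assoc, abs_mul]
      exact mul_le_of_le_one_left (abs_nonneg _) (hΨ1 _)
    · refine (mul_le_mul_of_nonneg_left (le_abs_self _)
        (mul_nonneg (hsdn v) (Real.sqrt_nonneg _))).trans ?_
      exact mul_le_mul_of_nonneg_right (den_le (hsdn v) (hsdσ v)) (abs_nonneg _)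
  have hone : (1 : ENNReal) ≤ P S + P Sᶜ := by
    rw [← measure_univ (μ := P), ← Set.union_compl_self S]
    exact measure_union_le _ _
  rw [ENNReal.ofReal_sub _ (Real.exp_pos _).le, ENNReal.ofReal_one]
  refine tsub_le_iff_right.2 (hone.trans ?_)
  gcongr
  exact hSc.trans hbor
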